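/- arXiv:2309.09757 — 3 statements merged into one kernel-verified Lean document; each statement's English description precedes it below -/
import Mathlib

section
/- Let M ⊂ ℂⁿ (n ≥ 2) be a smooth real hypersurface and L a smooth CR vector field along M that vanishes at no point. If f, g are germs of real-valued smooth functions on M at p ∈ M with 0 ≤ f ≤ g near p and f(p) = g(p), then ν_L(f)(p) ≥ ν_L(g)(p). -/
open Topology

/-- ℂⁿ as a Pi type. -/
abbrev Cn (n : ℕ) := Fin n → ℂ

/-- The Wirtinger derivative `∂f/∂z_j` of a (real-)smooth function `f : ℂⁿ → ℂ`. -/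
noncomputable def wz {n : ℕ} (j : Fin n) (f : Cn n → ℂ) (x : Cn n) : ℂ :=
  (fderiv ℝ f x (Pi.single j 1) - Complex.I * fderiv ℝ f x (Pi.single j Complex.I)) / 2

/-- The Wirtinger derivative `∂f/∂z̄_j` of a (real-)smooth function `f : ℂⁿ → ℂ`. -/
noncomputable def wzb {n : ℕ} (j : Fin n) (f : Cn n → ℂ) (x : Cn n) : ℂ :=
  (fderiv ℝ f x (Pi.single j 1) + Complex.I * fderiv ℝ f x (Pi.single j Complex.I)) / 2

/-- The complexification of a real-valued function on ℂⁿ. -/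
def cx {n : ℕ} (ρ : Cn n → ℝ) : Cn n → ℂ := fun x => (ρ x : ℂ)

/-- A complex vector field of mixed type `(1,0) + (0,1)` on ℂⁿ:
`W = Σ_j hol_j ∂/∂z_j + Σ_j anti_j ∂/∂z̄_j`. -/
structure CVF (n : ℕ) where
  hol : Fin n → Cn n → ℂ
  anti : Fin n → Cn n → ℂ

/-- Action of a mixed-type complex vector field on functions, as a derivation. -/
noncomputable def CVF.act {n : ℕ} (W : CVF n) (f : Cn n → ℂ) : Cn n → ℂ :=
  fun x => (∑ j, W.hol j x * wz j f x) + (∑ j, W.anti j x * wzb j f x)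

/-- Lie bracket of two mixed-type complex vector fields (with smooth coefficients the
commutator `[V,W]` of the first–order operators is again first order with these
coefficients). -/
noncomputable def CVF.bracket {n : ℕ} (V W : CVF n) : CVF n where
  hol := fun j x => V.act (W.hol j) x - W.act (V.hol j) x
  anti := fun j x => V.act (W.anti j) x - W.act (V.anti j) x

/-- The `(1,0)` vector field `L = Σ_j a_j ∂/∂z_j`. -/
def LVF {n : ℕ} (a : Fin n → Cn n → ℂ) : CVF n := ⟨a, fun _ _ => 0⟩

/-- The conjugate `(0,1)` vector field `L̄ = Σ_j ā_j ∂/∂z̄_j`. -/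
def LbarVF {n : ℕ} (a : Fin n → Cn n → ℂ) : CVF n :=
  ⟨fun _ _ => 0, fun j x => starRingEnd ℂ (a j x)⟩

/-- `a` is a smooth CR vector field along `M = {ρ = 0}`: smooth coefficients annihilating
`ρ` in the `(1,0)` directions, i.e. `Σ_j a_j ∂ρ/∂z_j = 0` on `M`. -/
def IsCRField {n : ℕ} (ρ : Cn n → ℝ) (M : Set (Cn n)) (a : Fin n → Cn n → ℂ) : Prop :=
  (∀ j, ContDiff ℝ (⊤ : ℕ∞) (a j)) ∧ ∀ x ∈ M, ∑ j, a j x * wz j (cx ρ) x = 0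

/-- Membership in the module `𝓜₁(L)` generated over smooth functions by `L` and `L̄`. -/
def InM1 {n : ℕ} (a : Fin n → Cn n → ℂ) (W : CVF n) : Prop :=
  ∃ c₁ c₂ : Cn n → ℂ, ContDiff ℝ (⊤ : ℕ∞) c₁ ∧ ContDiff ℝ (⊤ : ℕ∞) c₂ ∧
    (∀ j x, W.hol j x = c₁ x * a j x) ∧ (∀ j x, W.anti j x = c₂ x * starRingEnd ℂ (a j x))

/-- `ν_L(f)(p)`: the smallest `m` such that `Y_m(⋯(Y_1 f)⋯)(p) ≠ 0` for some
`Y₁, …, Y_m ∈ 𝓜₁(L)`; `⊤` if no such `m` exists. -/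
noncomputable def nuL {n : ℕ} (a : Fin n → Cn n → ℂ) (f : Cn n → ℂ) (p : Cn n) : ℕ∞ :=
  sInf {m : ℕ∞ | ∃ Ws : List (CVF n), (Ws.length : ℕ∞) = m ∧ (∀ W ∈ Ws, InM1 a W) ∧
    (Ws.foldl (fun g W => W.act g) f) p ≠ 0}

/-- The coefficient `∂²ρ/∂z_j ∂z̄_l` of the Levi form. -/
noncomputable def leviCoeff {n : ℕ} (ρ : Cn n → ℝ) (j l : Fin n) (x : Cn n) : ℂ :=
  wz j (wzb l (cx ρ)) x

/-- The Levi form `λ(X,Y) = Σ_{j,l} (∂²ρ/∂z_j∂z̄_l) ξ_j η̄_l` of the fields with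
coefficients `ξ`, `η`, as a function on ℂⁿ. -/
noncomputable def levi {n : ℕ} (ρ : Cn n → ℝ) (ξ η : Fin n → Cn n → ℂ) (x : Cn n) : ℂ :=
  ∑ j, ∑ l, leviCoeff ρ j l x * ξ j x * starRingEnd ℂ (η l x)

/-- `M = {ρ = 0}` is pseudoconvex: the Levi form is positive semi-definite on the
CR directions at every point of `M`. -/
def Pseudoconvex {n : ℕ} (ρ : Cn n → ℝ) (M : Set (Cn n)) : Prop :=
  ∀ x ∈ M, ∀ ξ : Fin n → ℂ, (∑ j, ξ j * wz j (cx ρ) x) = 0 →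
    0 ≤ (∑ j, ∑ l, leviCoeff ρ j l x * ξ j * starRingEnd ℂ (ξ l)).re

/-- Iterated commutators of length `μ` of elements of `𝓜₁(L)`:
`[Y_μ, [Y_{μ-1}, ⋯ [Y₂, Y₁]⋯]]` with each `Y_i ∈ 𝓜₁(L)`. -/
inductive IsCommOf {n : ℕ} (a : Fin n → Cn n → ℂ) : ℕ → CVF n → Prop
  | one (W : CVF n) : InM1 a W → IsCommOf a 1 W
  | succ {μ : ℕ} (V W : CVF n) : InM1 a V → IsCommOf a μ W → IsCommOf a (μ + 1) (V.bracket W)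

/-- The pairing `⟨∂ρ, G⟩(p)` of a mixed-type field with the `(1,0)` form `∂ρ`. -/
noncomputable def pairDRho {n : ℕ} (ρ : Cn n → ℝ) (G : CVF n) (p : Cn n) : ℂ :=
  ∑ j, G.hol j p * wz j (cx ρ) p

/-- The commutator type `t_L(M,p)`: the smallest `m` such that `⟨∂ρ, G⟩(p) ≠ 0` for some
iterated commutator `G` of length (at most) `m` of elements of `𝓜₁(L)`; `⊤` if none. -/
noncomputable def tType {n : ℕ} (ρ : Cn n → ℝ) (a : Fin n → Cn n → ℂ) (p : Cn n) : ℕ∞ :=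
  sInf {m : ℕ∞ | ∃ μ : ℕ, (μ : ℕ∞) = m ∧ ∃ G : CVF n, IsCommOf a μ G ∧ pairDRho ρ G p ≠ 0}

/-- The Levi-form type `c_L(M,p) = 2 + ν_L(λ(L,L))(p)`. -/
noncomputable def cType {n : ℕ} (ρ : Cn n → ℝ) (a : Fin n → Cn n → ℂ) (p : Cn n) : ℕ∞ :=
  2 + nuL a (levi ρ a a) p

section LieDerivative

open Asymptotics Filter Metric

variable {E : Type*} [NormedAddCommGroup E] [NormedSpace ℝ E]

/-- The derivative of a complex-valued function along a real vector field. -/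
noncomputable def lieD (X : E → E) (h : E → ℂ) : E → ℂ := fun x => fderiv ℝ h x (X x)

theorem contDiff_lieD {X : E → E} {h : E → ℂ} (hX : ContDiff ℝ (⊤ : ℕ∞) X)
    (hh : ContDiff ℝ (⊤ : ℕ∞) h) : ContDiff ℝ (⊤ : ℕ∞) (lieD X h) :=
  (hh.fderiv_right (m := (⊤ : ℕ∞)) (by simp)).clm_apply hX

theorem contDiff_iterate_lieD {X : E → E} {h : E → ℂ} (hX : ContDiff ℝ (⊤ : ℕ∞) X)
    (hh : ContDiff ℝ (⊤ : ℕ∞) h) (j : ℕ) : ContDiff ℝ (⊤ : ℕ∞) ((lieD X)^[j] h) := by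
  induction j generalizing h with
  | zero => exact hh
  | succ j ih => exact ih (contDiff_lieD hX hh)

theorem hasDerivAt_sum_pow_div_factorial_smul (c : ℕ → ℂ) (N : ℕ) (t : ℝ) :
    HasDerivAt (fun t : ℝ => ∑ j ∈ Finset.range (N + 1), (t ^ j / (j.factorial : ℝ)) • c j)
      (∑ j ∈ Finset.range N, (t ^ j / (j.factorial : ℝ)) • c (j + 1)) t := by
  have hterm : ∀ j : ℕ, HasDerivAt (fun t : ℝ => t ^ (j + 1) / ((j + 1).factorial : ℝ))
      (t ^ j / (j.factorial : ℝ)) t := by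
    intro j
    have := (hasDerivAt_pow (j + 1) t).div_const ((j + 1).factorial : ℝ)
    refine this.congr_deriv ?_
    have h1 : ((j : ℝ) + 1) ≠ 0 := by positivity
    have h2 : (j.factorial : ℝ) ≠ 0 := by positivity
    simp only [Nat.factorial_succ, Nat.cast_mul, Nat.cast_add, Nat.cast_one, add_tsub_cancel_right]
    field_simp
  have hsum := (HasDerivAt.fun_sum (u := Finset.range N) fun j _ =>
    (hterm j).smul_const (c (j + 1))).add_const (c 0)
  simpa [Finset.sum_range_succ'] using hsum

/-- Taylor expansion along integral curves, with a remainder uniform in the curve. -/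
theorem exists_taylor_bound_integralCurve {X : E → E} (hX : ContDiff ℝ (⊤ : ℕ∞) X) (p : E)
    (N : ℕ) {h : E → ℂ} (hh : ContDiff ℝ (⊤ : ℕ∞) h) :
    ∃ C : ℝ, 0 ≤ C ∧ ∃ U ∈ 𝓝 p, ∀ (γ : ℝ → E) (T : ℝ),
      (∀ t, |t| ≤ T → HasDerivAt γ (X (γ t)) t ∧ γ t ∈ U) → ∀ t, |t| ≤ T →
      ‖h (γ t) - ∑ j ∈ Finset.range N, (t ^ j / (j.factorial : ℝ)) • ((lieD X)^[j] h) (γ 0)‖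
        ≤ C * |t| ^ N := by
  induction N generalizing h with
  | zero =>
    refine ⟨‖h p‖ + 1, by positivity, {x | ‖h x‖ < ‖h p‖ + 1}, ?_, ?_⟩
    · exact (hh.continuous.norm.continuousAt).eventually_lt continuousAt_const (by simp)
    · intro γ T hγ t ht
      simpa using (hγ t ht).2.le
  | succ N ih =>
    obtain ⟨C, hC, U, hU, H⟩ := ih (contDiff_lieD hX hh)
    refine ⟨C, hC, U, hU, fun γ T hγ t ht => ?_⟩
    have hder : ∀ τ, |τ| ≤ T → HasDerivAt (fun τ : ℝ => h (γ τ) -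
        ∑ j ∈ Finset.range (N + 1), (τ ^ j / (j.factorial : ℝ)) • ((lieD X)^[j] h) (γ 0))
        (lieD X h (γ τ) - ∑ j ∈ Finset.range N,
          (τ ^ j / (j.factorial : ℝ)) • ((lieD X)^[j] (lieD X h)) (γ 0)) τ := by
      intro τ hτ
      refine HasDerivAt.sub ?_
        (hasDerivAt_sum_pow_div_factorial_smul (fun j => ((lieD X)^[j] h) (γ 0)) N τ)
      exact ((hh.differentiable (by simp)) (γ τ)).hasFDerivAt.comp_hasDerivAt τ (hγ τ hτ).1
    have hseg : ∀ τ ∈ Set.uIcc 0 t, |τ| ≤ |t| := by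
      intro τ hτ
      have := Set.abs_sub_left_of_mem_uIcc hτ
      simpa using this
    have := (convex_uIcc (0 : ℝ) t).norm_image_sub_le_of_norm_hasDerivWithin_le
      (C := C * |t| ^ N)
      (fun τ hτ => (hder τ ((hseg τ hτ).trans ht)).hasDerivWithinAt)
      (fun τ hτ => (H γ T hγ τ ((hseg τ hτ).trans ht)).trans
        (mul_le_mul_of_nonneg_left (pow_le_pow_left₀ (abs_nonneg _) (hseg τ hτ) N) hC))
      Set.left_mem_uIcc Set.right_mem_uIcc
    have h0 : ∑ j ∈ Finset.range (N + 1), ((0 : ℝ) ^ j / (j.factorial : ℝ)) •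
        ((lieD X)^[j] h) (γ 0) = h (γ 0) := by
      simp [Finset.sum_range_succ']
    rw [h0] at this
    simpa [pow_succ, mul_assoc] using this

/-- A vector field tangent to a regular hypersurface `{ρ = 0}` has a continuous local flow
preserving the hypersurface. -/
theorem exists_flow_of_tangent [CompleteSpace E] {X : E → E} (hX : ContDiff ℝ (⊤ : ℕ∞) X)
    {ρ : E → ℝ} (hρ : ContDiff ℝ (⊤ : ℕ∞) ρ) (htan : ∀ x, ρ x = 0 → fderiv ℝ ρ x (X x) = 0)
    {p : E} (hreg : fderiv ℝ ρ p ≠ 0) :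
    ∃ Φ : E × ℝ → E, Tendsto Φ (𝓝 (p, 0)) (𝓝 p) ∧ ∃ δ > 0, ∀ x ∈ ball p δ, ρ x = 0 →
      Φ (x, 0) = x ∧ ∀ t, |t| < δ →
        ρ (Φ (x, t)) = 0 ∧ HasDerivAt (fun t => Φ (x, t)) (X (Φ (x, t))) t := by
  obtain ⟨v, hv⟩ : ∃ v, fderiv ℝ ρ p v ≠ 0 := by
    by_contra! hcon
    exact hreg (ContinuousLinearMap.ext hcon)
  have hdρ : ContDiff ℝ (⊤ : ℕ∞) (fderiv ℝ ρ) := hρ.fderiv_right (by simp)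
  have hdv : ContDiff ℝ (⊤ : ℕ∞) (fun x => fderiv ℝ ρ x v) := hdρ.clm_apply contDiff_const
  have hdX : ContDiff ℝ (⊤ : ℕ∞) (fun x => fderiv ℝ ρ x (X x)) := hdρ.clm_apply hX
  set Y : E → E := fun x => X x - (fderiv ℝ ρ x (X x) / fderiv ℝ ρ x v) • v with hY
  have hYp : ContDiffAt ℝ 1 Y p := by
    have : ContDiffAt ℝ (⊤ : ℕ∞) Y p :=
      hX.contDiffAt.sub ((hdX.contDiffAt.div hdv.contDiffAt hv).smul contDiffAt_const)
    exact this.of_le (by exact_mod_cast le_top)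
  obtain ⟨e, he, a, r, L, K, hr, hpl⟩ := IsPicardLindelof.of_contDiffAt_one hYp
  obtain ⟨Φ, hΦ, hcont⟩ :=
    (hpl 0).exists_forall_mem_closedBall_eq_hasDerivWithinAt_continuousOn
  simp only [zero_sub, zero_add] at hΦ hcont
  have hnhds : closedBall p (r : ℝ) ×ˢ Set.Icc (-e) e ∈ 𝓝 ((p, 0) : E × ℝ) :=
    prod_mem_nhds (closedBall_mem_nhds p hr) (Icc_mem_nhds (by linarith) he)
  have hT : Tendsto Φ (𝓝 (p, 0)) (𝓝 p) := by
    have h1 : ContinuousAt Φ (p, 0) := hcont.continuousAt hnhds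
    have h2 : Φ (p, 0) = p := (hΦ p (mem_closedBall_self r.2)).1
    simpa [ContinuousAt, h2] using h1
  have hV : ∀ᶠ x in 𝓝 p, fderiv ℝ ρ x v ≠ 0 := hdv.continuous.continuousAt.eventually_ne hv
  obtain ⟨δ, hδ, hδV⟩ := Metric.mem_nhds_iff.1 (inter_mem (hT hV) hnhds)
  refine ⟨Φ, hT, δ, hδ, fun x hx hρx => ?_⟩
  have hmem : ∀ t : ℝ, |t| < δ → (x, t) ∈ ball ((p, 0) : E × ℝ) δ := by
    intro t ht
    rw [← ball_prod_same]
    exact ⟨hx, by simpa using ht⟩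
  have hxr : x ∈ closedBall p (r : ℝ) := (hδV (hmem 0 (by simpa using hδ))).2.1
  obtain ⟨hx0, hxd⟩ := hΦ x hxr
  have hder : ∀ t, |t| < δ → HasDerivAt (fun t => Φ (x, t)) (Y (Φ (x, t))) t := by
    intro t ht
    refine (hxd t (hδV (hmem t ht)).2.2).hasDerivAt ?_
    have hsub : ball (0 : ℝ) δ ⊆ Set.Icc (-e) e := fun τ hτ =>
      (hδV (hmem τ (by simpa using hτ))).2.2
    exact mem_of_superset (isOpen_ball.mem_nhds (by simpa using ht)) hsub
  have hzero : ∀ t, |t| < δ → ρ (Φ (x, t)) = 0 := by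
    intro t ht
    have hd : ∀ τ ∈ ball (0 : ℝ) δ,
        HasDerivWithinAt (fun τ => ρ (Φ (x, τ))) 0 (ball (0 : ℝ) δ) τ := by
      intro τ hτ
      have hτ' : |τ| < δ := by simpa using hτ
      have hne : fderiv ℝ ρ (Φ (x, τ)) v ≠ 0 := (hδV (hmem τ hτ')).1
      have := ((hρ.differentiable (by simp)) (Φ (x, τ))).hasFDerivAt.comp_hasDerivAt τ
        (hder τ hτ')
      have hz : fderiv ℝ ρ (Φ (x, τ)) (Y (Φ (x, τ))) = 0 := by
        simp [hY, hne]
      rw [hz] at this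
      exact this.hasDerivWithinAt
    have := (convex_ball (0 : ℝ) δ).norm_image_sub_le_of_norm_hasDerivWithin_le (C := 0) hd
      (by simp) (mem_ball_self hδ) (show t ∈ ball (0 : ℝ) δ by simpa using ht)
    simpa [hx0, hρx] using this
  refine ⟨hx0, fun t ht => ⟨hzero t ht, ?_⟩⟩
  have := hder t ht
  have hYX : Y (Φ (x, t)) = X (Φ (x, t)) := by
    simp [hY, htan _ (hzero t ht)]
  rwa [hYX] at this

theorem exists_curve_step [CompleteSpace E] {X : E → E} (hX : ContDiff ℝ (⊤ : ℕ∞) X)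
    {ρ : E → ℝ} (hρ : ContDiff ℝ (⊤ : ℕ∞) ρ) (htan : ∀ x, ρ x = 0 → fderiv ℝ ρ x (X x) = 0)
    {p : E} (hreg : fderiv ℝ ρ p ≠ 0) (s : ℝ) {y : ℝ → E} (hy : Tendsto y (𝓝 0) (𝓝 p))
    (hyM : ∀ᶠ ε in 𝓝 0, ρ (y ε) = 0) :
    ∃ z : ℝ → E, Tendsto z (𝓝 0) (𝓝 p) ∧ (∀ᶠ ε in 𝓝 0, ρ (z ε) = 0) ∧
      ∀ h : E → ℂ, ContDiff ℝ (⊤ : ℕ∞) h → ∀ N : ℕ,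
        (fun ε : ℝ => h (z ε) - ∑ j ∈ Finset.range N,
          ((s * ε) ^ j / (j.factorial : ℝ)) • ((lieD X)^[j] h) (y ε)) =O[𝓝 0]
        fun ε : ℝ => ε ^ N := by
  obtain ⟨Φ, hΦ, δ, hδ, H⟩ := exists_flow_of_tangent hX hρ htan hreg
  have hs : Tendsto (fun ε : ℝ => s * ε) (𝓝 0) (𝓝 0) := by
    have : Continuous fun ε : ℝ => s * ε := by fun_prop
    simpa using this.tendsto 0
  have hsmall : ∀ η > 0, ∀ᶠ ε in 𝓝 (0 : ℝ), y ε ∈ ball p η ∧ |s * ε| < η := by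
    intro η hη
    filter_upwards [hy (ball_mem_nhds p hη), hs (ball_mem_nhds 0 hη)] with ε h1 hε
    exact ⟨h1, by simpa using hε⟩
  refine ⟨fun ε => Φ (y ε, s * ε), hΦ.comp (hy.prodMk_nhds hs), ?_, ?_⟩
  · filter_upwards [hyM, hsmall δ hδ] with ε h1 h2
    exact ((H _ h2.1 h1).2 _ h2.2).1
  · intro h hh N
    obtain ⟨C, hC, U, hU, hT⟩ := exists_taylor_bound_integralCurve hX p N hh
    obtain ⟨η, hη, hηU⟩ := Metric.mem_nhds_iff.1 (hΦ hU)
    refine IsBigO.of_bound (C * |s| ^ N) ?_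
    filter_upwards [hyM, hsmall δ hδ, hsmall η hη] with ε h1 h2 h3
    obtain ⟨h0, h4⟩ := H _ h2.1 h1
    have := hT (fun t => Φ (y ε, t)) |s * ε| (fun t ht => ⟨(h4 t (ht.trans_lt h2.2)).2, hηU (by
      rw [← ball_prod_same]
      exact ⟨h3.1, by simpa using ht.trans_lt h3.2⟩)⟩) (s * ε) le_rfl
    rw [h0] at this
    refine this.trans (le_of_eq ?_)
    simp [abs_mul, mul_pow, mul_assoc]

/-- The coefficient of `ε ^ d` in the formal expansion at `p` of
`exp (ε s₁ X₁) (exp (ε s₂ X₂) (⋯ h))`. -/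
noncomputable def flowCoeff (p : E) : List (ℝ × (E → E)) → (E → ℂ) → ℕ → ℂ
  | [], h, d => if d = 0 then h p else 0
  | q :: l, h, d => ∑ j ∈ Finset.range (d + 1),
      (q.1 ^ j / (j.factorial : ℝ)) • flowCoeff p l ((lieD q.2)^[j] h) (d - j)

theorem exists_curve_expansion [CompleteSpace E] {ρ : E → ℝ} (hρ : ContDiff ℝ (⊤ : ℕ∞) ρ)
    {p : E} (hp : ρ p = 0) (hreg : fderiv ℝ ρ p ≠ 0) (l : List (ℝ × (E → E)))
    (hl : ∀ q ∈ l, ContDiff ℝ (⊤ : ℕ∞) q.2 ∧ ∀ x, ρ x = 0 → fderiv ℝ ρ x (q.2 x) = 0) :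
    ∃ y : ℝ → E, Tendsto y (𝓝 0) (𝓝 p) ∧ (∀ᶠ ε in 𝓝 0, ρ (y ε) = 0) ∧
      ∀ h : E → ℂ, ContDiff ℝ (⊤ : ℕ∞) h → ∀ N : ℕ,
        (fun ε : ℝ => h (y ε) - ∑ d ∈ Finset.range N, ε ^ d • flowCoeff p l h d) =O[𝓝 0]
        fun ε : ℝ => ε ^ N := by
  induction l with
  | nil =>
    refine ⟨fun _ => p, tendsto_const_nhds, by simp [hp], fun h _ N => ?_⟩
    cases N with
    | zero => simpa using isBigO_const_const (h p) (one_ne_zero (α := ℝ)) _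
    | succ N =>
      have : ∀ ε : ℝ, h p - ∑ d ∈ Finset.range (N + 1), ε ^ d • flowCoeff p [] h d = 0 := by
        intro ε
        simp [flowCoeff]
      simp only [this]
      exact isBigO_zero _ _
  | cons q l ih =>
    obtain ⟨y, hy, hyM, hexp⟩ := ih fun q' hq' => hl q' (List.mem_cons_of_mem _ hq')
    obtain ⟨hX, htan⟩ := hl q List.mem_cons_self
    obtain ⟨z, hz, hzM, hstep⟩ := exists_curve_step hX hρ htan hreg q.1 hy hyM
    refine ⟨z, hz, hzM, fun h hh N => ?_⟩
    have hsum : (fun ε : ℝ => ∑ j ∈ Finset.range N, ((q.1 * ε) ^ j / (j.factorial : ℝ)) •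
        (((lieD q.2)^[j] h) (y ε) - ∑ d ∈ Finset.range (N - j),
          ε ^ d • flowCoeff p l ((lieD q.2)^[j] h) d)) =O[𝓝 0] fun ε : ℝ => ε ^ N := by
      refine IsBigO.fun_sum fun j hj => ?_
      have hjN : j + (N - j) = N := by
        have := Finset.mem_range.1 hj
        omega
      have h1 := hexp _ (contDiff_iterate_lieD hX hh j) (N - j)
      have h2 : (fun ε : ℝ => (q.1 * ε) ^ j / (j.factorial : ℝ)) =O[𝓝 0]
          fun ε : ℝ => ε ^ j := by
        have : (fun ε : ℝ => (q.1 * ε) ^ j / (j.factorial : ℝ)) =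
            fun ε : ℝ => (q.1 ^ j / (j.factorial : ℝ)) * ε ^ j := by
          ext ε
          ring
        rw [this]
        exact isBigO_const_mul_self _ _ _
      have h3 := h2.smul h1
      simpa only [smul_eq_mul, ← pow_add, hjN] using h3
    refine ((hstep h hh N).add hsum).congr_left fun ε => ?_
    have hflip := Finset.sum_range_diag_flip N fun j d =>
      ((q.1 * ε) ^ j / (j.factorial : ℝ)) • ε ^ d • flowCoeff p l ((lieD q.2)^[j] h) d
    have hcoef : ∑ d ∈ Finset.range N, ε ^ d • flowCoeff p (q :: l) h d =
        ∑ j ∈ Finset.range N, ∑ d ∈ Finset.range (N - j), ((q.1 * ε) ^ j / (j.factorial : ℝ)) •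
          ε ^ d • flowCoeff p l ((lieD q.2)^[j] h) d := by
      rw [← hflip]
      refine Finset.sum_congr rfl fun d _ => ?_
      rw [flowCoeff, Finset.smul_sum]
      refine Finset.sum_congr rfl fun j hj => ?_
      have hjd : j + (d - j) = d := by
        have := Finset.mem_range.1 hj
        omega
      rw [smul_smul, smul_smul]
      congr 1
      have hpow : ε ^ d = ε ^ j * ε ^ (d - j) := by rw [← pow_add, hjd]
      rw [hpow, mul_pow]
      ring
    rw [hcoef]
    simp only [smul_sub, Finset.sum_sub_distrib, Finset.smul_sum]
    ring

theorem coeff_eq_zero_of_isBigO (N : ℕ) (c : ℕ → ℂ)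
    (hc : (fun ε : ℝ => ∑ d ∈ Finset.range N, ε ^ d • c d) =O[𝓝[≠] 0] fun ε : ℝ => ε ^ N) :
    ∀ d < N, c d = 0 := by
  induction N generalizing c with
  | zero => simp
  | succ N ih =>
    have hc0 : c 0 = 0 := by
      have h1 : Tendsto (fun ε : ℝ => ∑ d ∈ Finset.range (N + 1), ε ^ d • c d)
          (𝓝[≠] 0) (𝓝 (c 0)) := by
        have : Continuous fun ε : ℝ => ∑ d ∈ Finset.range (N + 1), ε ^ d • c d := by fun_prop
        have h := this.tendsto 0
        have h0 : ∑ d ∈ Finset.range (N + 1), (0 : ℝ) ^ d • c d = c 0 := by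
          simp [Finset.sum_range_succ']
        rw [h0] at h
        exact h.mono_left nhdsWithin_le_nhds
      have h2 : Tendsto (fun ε : ℝ => ε ^ (N + 1)) (𝓝[≠] 0) (𝓝 0) := by
        have : Continuous fun ε : ℝ => ε ^ (N + 1) := by fun_prop
        have h := this.tendsto 0
        rw [zero_pow (Nat.succ_ne_zero N)] at h
        exact h.mono_left nhdsWithin_le_nhds
      exact tendsto_nhds_unique h1 (hc.trans_tendsto h2)
    have hdiv : (fun ε : ℝ => ∑ d ∈ Finset.range N, ε ^ d • c (d + 1)) =O[𝓝[≠] 0]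
        fun ε : ℝ => ε ^ N := by
      have h1 := (isBigO_refl (fun ε : ℝ => ε⁻¹) (𝓝[≠] 0)).smul hc
      refine h1.congr' ?_ ?_
      · filter_upwards [self_mem_nhdsWithin] with ε hε
        have hε : ε ≠ 0 := hε
        rw [Finset.sum_range_succ', hc0, smul_zero, add_zero, Finset.smul_sum]
        refine Finset.sum_congr rfl fun d _ => ?_
        rw [smul_smul, pow_succ]
        congr 1
        field_simp
      · filter_upwards [self_mem_nhdsWithin] with ε hε
        have hε : ε ≠ 0 := hε
        rw [smul_eq_mul, pow_succ]
        field_simp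
    intro d hd
    cases d with
    | zero => exact hc0
    | succ d => exact ih (fun d => c (d + 1)) hdiv d (by omega)

theorem flowCoeff_eq_zero {P : (E → E) → Prop} (p : E) (l : List (ℝ × (E → E)))
    (hl : ∀ q ∈ l, P q.2) (h : E → ℂ) (d : ℕ)
    (hw : ∀ Xs : List (E → E), (∀ X ∈ Xs, P X) → Xs.length ≤ d →
      Xs.foldl (fun h X => lieD X h) h p = 0) : flowCoeff p l h d = 0 := by
  induction l generalizing h d with
  | nil =>
    have := hw [] (by simp) (Nat.zero_le _)
    simp only [List.foldl_nil] at this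
    simp [flowCoeff, this]
  | cons q l ih =>
    rw [flowCoeff]
    refine Finset.sum_eq_zero fun j hj => ?_
    rw [ih (fun q' hq' => hl q' (List.mem_cons_of_mem _ hq')) _ _ fun Xs hXs hlen => ?_, smul_zero]
    have hfold : ∀ (j : ℕ) (h : E → ℂ), (List.replicate j q.2).foldl (fun h X => lieD X h) h =
        (lieD q.2)^[j] h := by
      intro j
      induction j with
      | zero => simp
      | succ j ihj => intro h; simp [List.replicate_succ, ihj]
    have := hw (List.replicate j q.2 ++ Xs) (by
      intro X hX
      rcases List.mem_append.1 hX with hX | hX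
      · rw [List.eq_of_mem_replicate hX]
        exact hl q List.mem_cons_self
      · exact hXs X hX) (by
      have := Finset.mem_range.1 hj
      simp only [List.length_append, List.length_replicate]
      omega)
    rwa [List.foldl_append, hfold] at this

theorem foldl_lieD_eq_zero_of_flowCoeff (p : E) (Xs : List (E → E)) (h : E → ℂ)
    (hQ : ∀ l : List (ℝ × (E → E)), l.map Prod.snd = Xs → flowCoeff p l h Xs.length = 0) :
    Xs.foldl (fun h X => lieD X h) h p = 0 := by
  induction Xs generalizing h with
  | nil => simpa [flowCoeff] using hQ [] rfl
  | cons X Xs ih =>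
    refine ih _ fun l hl => ?_
    have hpoly : ∀ s : ℝ, ∑ j ∈ Finset.range (Xs.length + 1 + 1), s ^ j •
        ((1 / (j.factorial : ℝ)) • flowCoeff p l ((lieD X)^[j] h) (Xs.length + 1 - j)) = 0 := by
      intro s
      have := hQ ((s, X) :: l) (by simp [hl])
      rw [flowCoeff] at this
      rw [← this]
      refine Finset.sum_congr rfl fun j _ => ?_
      rw [smul_smul, mul_one_div]
      rfl
    have := coeff_eq_zero_of_isBigO (Xs.length + 1 + 1) _
      ((isBigO_zero _ _).congr_left fun s => (hpoly s).symm) 1 (by omega)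
    simpa using this

/-- If `‖f‖ ≤ ‖g‖` on a hypersurface near `p` and all words of length at most `m` in
tangent fields of a class annihilate `g` at `p`, then words of length `m` annihilate `f`. -/
theorem foldl_lieD_eq_zero_of_norm_le [CompleteSpace E] {ρ : E → ℝ}
    (hρ : ContDiff ℝ (⊤ : ℕ∞) ρ) {p : E} (hp : ρ p = 0) (hreg : fderiv ℝ ρ p ≠ 0)
    {P : (E → E) → Prop}
    (hP : ∀ X, P X → ContDiff ℝ (⊤ : ℕ∞) X ∧ ∀ x, ρ x = 0 → fderiv ℝ ρ x (X x) = 0)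
    {f g : E → ℂ} (hf : ContDiff ℝ (⊤ : ℕ∞) f) (hg : ContDiff ℝ (⊤ : ℕ∞) g)
    (hfg : ∀ᶠ x in 𝓝 p, ρ x = 0 → ‖f x‖ ≤ ‖g x‖) (m : ℕ)
    (hw : ∀ Xs : List (E → E), (∀ X ∈ Xs, P X) → Xs.length ≤ m →
      Xs.foldl (fun h X => lieD X h) g p = 0)
    (Xs : List (E → E)) (hXs : ∀ X ∈ Xs, P X) (hlen : Xs.length = m) :
    Xs.foldl (fun h X => lieD X h) f p = 0 := by
  refine foldl_lieD_eq_zero_of_flowCoeff p Xs f fun l hl => ?_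
  have hlP : ∀ q ∈ l, P q.2 := fun q hq => hXs _ (hl ▸ List.mem_map_of_mem hq)
  obtain ⟨y, hy, hyM, hexp⟩ := exists_curve_expansion hρ hp hreg l fun q hq => hP _ (hlP q hq)
  have hgO : (fun ε : ℝ => g (y ε)) =O[𝓝 0] fun ε : ℝ => ε ^ (m + 1) := by
    refine (hexp g hg (m + 1)).congr_left fun ε => ?_
    rw [Finset.sum_eq_zero, sub_zero]
    intro d hd
    rw [flowCoeff_eq_zero p l hlP g d fun Ys hYs hYd =>
      hw Ys hYs (hYd.trans (Nat.lt_succ_iff.1 (Finset.mem_range.1 hd))), smul_zero]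
  have hfO : (fun ε : ℝ => f (y ε)) =O[𝓝 0] fun ε : ℝ => ε ^ (m + 1) := by
    refine IsBigO.trans (IsBigO.of_bound 1 ?_) hgO
    filter_upwards [hyM, hy.eventually hfg] with ε h1 h2
    simpa using h2 h1
  have hsum := (hfO.sub (hexp f hf (m + 1))).congr_left fun ε => sub_sub_cancel _ _
  exact coeff_eq_zero_of_isBigO (m + 1) _ (hsum.mono nhdsWithin_le_nhds) _ (by omega)

end LieDerivative

section Hypersurface

/-- The real vector field `b L + b̄ L̄` attached to a smooth function `b`. -/
def IsRealM1 {n : ℕ} (a : Fin n → Cn n → ℂ) (X : Cn n → Cn n) : Prop :=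
  ∃ b : Cn n → ℂ, ContDiff ℝ (⊤ : ℕ∞) b ∧ X = fun x j => b x * a j x

theorem fderiv_apply_eq_sum {n : ℕ} {F : Type*} [NormedAddCommGroup F] [NormedSpace ℝ F]
    (T : Cn n →L[ℝ] F) (v : Cn n) :
    T v = ∑ j, ((v j).re • T (Pi.single j 1) + (v j).im • T (Pi.single j Complex.I)) := by
  conv_lhs => rw [← Finset.univ_sum_single v]
  rw [map_sum]
  refine Finset.sum_congr rfl fun j _ => ?_
  rw [← map_smul, ← map_smul, ← map_add, ← Pi.single_smul, ← Pi.single_smul, ← Pi.single_add]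
  congr 2
  simp [Complex.re_add_im]

theorem IsRealM1.contDiff {n : ℕ} {a : Fin n → Cn n → ℂ}
    (ha : ∀ j, ContDiff ℝ (⊤ : ℕ∞) (a j)) {X : Cn n → Cn n} (hX : IsRealM1 a X) :
    ContDiff ℝ (⊤ : ℕ∞) X := by
  obtain ⟨b, hb, rfl⟩ := hX
  exact contDiff_pi.2 fun j => hb.mul (ha j)

theorem IsRealM1.tangent {n : ℕ} {ρ : Cn n → ℝ} (hρ : ContDiff ℝ (⊤ : ℕ∞) ρ)
    {M : Set (Cn n)} {a : Fin n → Cn n → ℂ} (ha : IsCRField ρ M a) {X : Cn n → Cn n}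
    (hX : IsRealM1 a X) {x : Cn n} (hx : x ∈ M) : fderiv ℝ ρ x (X x) = 0 := by
  obtain ⟨b, hb, rfl⟩ := hX
  have hcx : ∀ v, fderiv ℝ (cx ρ) x v = (fderiv ℝ ρ x v : ℂ) := by
    intro v
    have h1 : HasFDerivAt (cx ρ) (Complex.ofRealCLM.comp (fderiv ℝ ρ x)) x :=
      Complex.ofRealCLM.hasFDerivAt.comp x ((hρ.differentiable (by simp)) x).hasFDerivAt
    rw [h1.fderiv]
    rfl
  have h := congrArg (fun z => (2 * (b x * z)).re) (ha.2 x hx)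
  simp only [mul_zero, Complex.zero_re, Finset.mul_sum, Complex.re_sum] at h
  rw [fderiv_apply_eq_sum, ← h]
  refine Finset.sum_congr rfl fun j _ => ?_
  rw [wz, hcx, hcx]
  have : 2 * (b x * (a j x * (((fderiv ℝ ρ x (Pi.single j 1) : ℝ) : ℂ) -
      Complex.I * ((fderiv ℝ ρ x (Pi.single j Complex.I) : ℝ) : ℂ)) / 2)) =
      (b x * a j x) * (((fderiv ℝ ρ x (Pi.single j 1) : ℝ) : ℂ) -
      Complex.I * ((fderiv ℝ ρ x (Pi.single j Complex.I) : ℝ) : ℂ)) := by ring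
  rw [mul_div_assoc] at this
  rw [this, Complex.mul_re]
  simp

theorem act_eq_lieD {n : ℕ} (a : Fin n → Cn n → ℂ) (b : Cn n → ℂ) (h : Cn n → ℂ) :
    CVF.act ⟨fun j x => b x * a j x, fun j x => starRingEnd ℂ (b x * a j x)⟩ h =
      lieD (fun x j => b x * a j x) h := by
  funext x
  rw [CVF.act, lieD, fderiv_apply_eq_sum, ← Finset.sum_add_distrib]
  refine Finset.sum_congr rfl fun j _ => ?_
  simp only [wz, wzb, Complex.real_smul]
  generalize b x * a j x = w
  generalize fderiv ℝ h x (Pi.single j 1) = u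
  generalize fderiv ℝ h x (Pi.single j Complex.I) = v
  apply Complex.ext <;> simp <;> ring

/-- Every element of `𝓜₁(L)` is `X + iY` with `X`, `Y` real elements. -/
theorem InM1.exists_act_eq {n : ℕ} {a : Fin n → Cn n → ℂ} {W : CVF n} (hW : InM1 a W) :
    ∃ X Y, IsRealM1 a X ∧ IsRealM1 a Y ∧ ∀ h : Cn n → ℂ,
      W.act h = fun x => lieD X h x + Complex.I * lieD Y h x := by
  obtain ⟨c₁, c₂, h₁, h₂, hhol, hanti⟩ := hW
  have hc : ContDiff ℝ (⊤ : ℕ∞) fun x => starRingEnd ℂ (c₂ x) :=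
    Complex.conjCLE.contDiff.comp h₂
  refine ⟨_, _, ⟨fun x => (c₁ x + starRingEnd ℂ (c₂ x)) / 2, (h₁.add hc).div_const _, rfl⟩,
    ⟨fun x => -Complex.I * ((c₁ x - starRingEnd ℂ (c₂ x)) / 2),
      contDiff_const.mul ((h₁.sub hc).div_const _), rfl⟩, fun h => ?_⟩
  rw [← act_eq_lieD, ← act_eq_lieD]
  funext x
  simp only [CVF.act, hhol, hanti, Finset.mul_sum, mul_add, ← Finset.sum_add_distrib]
  refine Finset.sum_congr rfl fun j _ => ?_
  simp only [map_mul, map_div₀, map_add, map_sub, map_neg, Complex.conj_I, Complex.conj_conj,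
    map_ofNat]
  linear_combination ((c₁ x - starRingEnd ℂ (c₂ x)) / 2 * a j x * wz j h x
    - (starRingEnd ℂ (c₁ x) - c₂ x) / 2 * starRingEnd ℂ (a j x) * wzb j h x) * Complex.I_sq

theorem lieD_add_I_mul {n : ℕ} (X : Cn n → Cn n) {h₁ h₂ : Cn n → ℂ}
    (hh₁ : Differentiable ℝ h₁) (hh₂ : Differentiable ℝ h₂) :
    lieD X (fun x => h₁ x + Complex.I * h₂ x) =
      fun x => lieD X h₁ x + Complex.I * lieD X h₂ x := by
  funext x
  have := (hh₁ x).hasFDerivAt.add ((hh₂ x).hasFDerivAt.const_mul Complex.I)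
  rw [lieD, HasFDerivAt.fderiv (f := fun x => h₁ x + Complex.I * h₂ x) this]
  simp [lieD]

theorem foldl_act_eq_zero {n : ℕ} {a : Fin n → Cn n → ℂ}
    (ha : ∀ j, ContDiff ℝ (⊤ : ℕ∞) (a j)) (p : Cn n) (Ws : List (CVF n))
    (hWs : ∀ W ∈ Ws, InM1 a W) {h : Cn n → ℂ} (hh : ContDiff ℝ (⊤ : ℕ∞) h)
    (hw : ∀ Xs : List (Cn n → Cn n), (∀ X ∈ Xs, IsRealM1 a X) → Xs.length = Ws.length →
      Xs.foldl (fun h X => lieD X h) h p = 0) :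
    Ws.foldl (fun g W => W.act g) h p = 0 := by
  induction Ws generalizing h with
  | nil => exact hw [] (by simp) rfl
  | cons W Ws ih =>
    obtain ⟨X, Y, hX, hY, hact⟩ := (hWs W List.mem_cons_self).exists_act_eq
    have hdX := contDiff_lieD (hX.contDiff ha) hh
    have hdY := contDiff_lieD (hY.contDiff ha) hh
    refine ih (fun W' hW' => hWs W' (List.mem_cons_of_mem _ hW')) ?_ fun Xs hXs hlen => ?_
    · beta_reduce
      rw [hact]
      exact hdX.add (contDiff_const.mul hdY)
    · have hlin : ∀ (Zs : List (Cn n → Cn n)), (∀ Z ∈ Zs, IsRealM1 a Z) → ∀ h₁ h₂ : Cn n → ℂ,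
          ContDiff ℝ (⊤ : ℕ∞) h₁ → ContDiff ℝ (⊤ : ℕ∞) h₂ →
          Zs.foldl (fun h X => lieD X h) (fun x => h₁ x + Complex.I * h₂ x) p =
            Zs.foldl (fun h X => lieD X h) h₁ p +
              Complex.I * Zs.foldl (fun h X => lieD X h) h₂ p := by
        intro Zs
        induction Zs with
        | nil => intros; rfl
        | cons Z Zs ihZ =>
          intro hZs h₁ h₂ hh₁ hh₂
          have hZ := (hZs Z List.mem_cons_self).contDiff ha
          simp only [List.foldl_cons]
          rw [lieD_add_I_mul Z (hh₁.differentiable (by simp)) (hh₂.differentiable (by simp))]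
          exact ihZ (fun Z' hZ' => hZs Z' (List.mem_cons_of_mem _ hZ')) _ _
            (contDiff_lieD hZ hh₁) (contDiff_lieD hZ hh₂)
      beta_reduce
      rw [hact, hlin Xs hXs _ _ hdX hdY]
      have e1 := hw (X :: Xs) (by simpa using ⟨hX, hXs⟩) (by simp [hlen])
      have e2 := hw (Y :: Xs) (by simpa using ⟨hY, hXs⟩) (by simp [hlen])
      rw [List.foldl_cons] at e1 e2
      rw [e1, e2]
      simp

theorem exists_foldl_act_eq {n : ℕ} {a : Fin n → Cn n → ℂ} (Xs : List (Cn n → Cn n))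
    (hXs : ∀ X ∈ Xs, IsRealM1 a X) :
    ∃ Ws : List (CVF n), Ws.length = Xs.length ∧ (∀ W ∈ Ws, InM1 a W) ∧ ∀ h : Cn n → ℂ,
      Ws.foldl (fun g W => W.act g) h = Xs.foldl (fun h X => lieD X h) h := by
  induction Xs with
  | nil => exact ⟨[], rfl, by simp, fun _ => rfl⟩
  | cons X Xs ih =>
    obtain ⟨Ws, hlen, hWs, hfold⟩ := ih fun X' hX' => hXs X' (List.mem_cons_of_mem _ hX')
    obtain ⟨b, hb, rfl⟩ := hXs X List.mem_cons_self
    refine ⟨⟨fun j x => b x * a j x, fun j x => starRingEnd ℂ (b x * a j x)⟩ :: Ws,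
      by simp [hlen], ?_, fun h => ?_⟩
    · intro W hW
      rcases List.mem_cons.1 hW with rfl | hW
      · exact ⟨b, fun x => starRingEnd ℂ (b x), hb, Complex.conjCLE.contDiff.comp hb,
          fun _ _ => rfl, fun j x => map_mul _ _ _⟩
      · exact hWs W hW
    · rw [List.foldl_cons, List.foldl_cons, act_eq_lieD, hfold]

end Hypersurface

/-- For a smooth real hypersurface `M ⊂ ℂⁿ` (`n ≥ 2`), a nowhere-vanishing
smooth CR vector field `L` along `M`, and germs `f, g` of real-valued smooth functions on `M`
at `p ∈ M` with `0 ≤ f ≤ g` on `M` near `p` and `f(p) = g(p)`, one has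
`ν_L(f)(p) ≥ ν_L(g)(p)`. -/
theorem nuL_mono {n : ℕ} (hn : 2 ≤ n) (ρ : Cn n → ℝ) (hρ : ContDiff ℝ (⊤ : ℕ∞) ρ)
    (M : Set (Cn n)) (hM : M = {x | ρ x = 0}) (hreg : ∀ x ∈ M, fderiv ℝ ρ x ≠ 0)
    (a : Fin n → Cn n → ℂ) (ha : IsCRField ρ M a)
    (hnv : ∀ x ∈ M, (fun j => a j x) ≠ 0)
    (p : Cn n) (hp : p ∈ M)
    (f g : Cn n → ℝ) (hf : ContDiff ℝ (⊤ : ℕ∞) f) (hg : ContDiff ℝ (⊤ : ℕ∞) g)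
    (hfg : ∀ᶠ x in 𝓝 p, x ∈ M → 0 ≤ f x ∧ f x ≤ g x) (heq : f p = g p) :
    nuL a (cx g) p ≤ nuL a (cx f) p := by
  subst hM
  refine le_sInf ?_
  rintro _ ⟨Ws, rfl, hWs, hne⟩
  by_contra! hlt
  refine hne (foldl_act_eq_zero ha.1 p Ws hWs (Complex.ofRealCLM.contDiff.comp hf)
    fun Xs hXs hlen => ?_)
  refine foldl_lieD_eq_zero_of_norm_le (P := IsRealM1 a) (g := cx g) hρ hp (hreg p hp)
    (fun X hX => ⟨hX.contDiff ha.1, fun x hx => hX.tangent hρ ha hx⟩)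
    (Complex.ofRealCLM.contDiff.comp hf) (Complex.ofRealCLM.contDiff.comp hg) ?_
    Ws.length (fun Ys hYs hYlen => ?_) Xs hXs hlen
  · filter_upwards [hfg] with x hx hx0
    obtain ⟨h0, h1⟩ := hx hx0
    simpa [cx, abs_of_nonneg h0, abs_of_nonneg (h0.trans h1)] using h1
  · obtain ⟨Vs, hVlen, hVs, hfold⟩ := exists_foldl_act_eq Ys hYs
    by_contra hYne
    have hle : nuL a (cx g) p ≤ Vs.length := sInf_le ⟨Vs, rfl, hVs, by rwa [hfold]⟩
    rw [hVlen] at hle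
    exact absurd hlt (not_lt.2 (hle.trans (by exact_mod_cast hYlen)))
end

section
/- Let M ⊂ ℂⁿ (n ≥ 2) be a smooth real hypersurface and let L₁,…,L_s be smooth CR vector fields along M whose values at every point of M are ℂ-linearly independent, spanning a rank-s subbundle B of T^{1,0}M. If f is a germ of a real-valued smooth function on M at p ∈ M with f ≥ 0 near p, then ν_B(f)(p) is either an even number or infinite. -/
open Topology

/-- Membership in the module `𝓜₁(B)` generated over smooth functions by the frame
`L₁, …, L_s` of `B` (with coefficient functions `A i`) and their conjugates. -/
def InM1B {n s : ℕ} (A : Fin s → Fin n → Cn n → ℂ) (W : CVF n) : Prop :=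
  ∃ c d : Fin s → Cn n → ℂ,
    (∀ i, ContDiff ℝ (⊤ : ℕ∞) (c i)) ∧ (∀ i, ContDiff ℝ (⊤ : ℕ∞) (d i)) ∧
    (∀ j x, W.hol j x = ∑ i, c i x * A i j x) ∧
    (∀ j x, W.anti j x = ∑ i, d i x * starRingEnd ℂ (A i j x))

/-- `ν_B(f)(p)`: the smallest `m` such that `Y_m(⋯(Y_1 f)⋯)(p) ≠ 0` for some
`Y₁, …, Y_m ∈ 𝓜₁(B)`; `⊤` if no such `m` exists. -/
noncomputable def nuB {n s : ℕ} (A : Fin s → Fin n → Cn n → ℂ) (f : Cn n → ℂ)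
    (p : Cn n) : ℕ∞ :=
  sInf {m : ℕ∞ | ∃ Ws : List (CVF n), (Ws.length : ℕ∞) = m ∧ (∀ W ∈ Ws, InM1B A W) ∧
    (Ws.foldl (fun g W => W.act g) f) p ≠ 0}

/-- The coefficients of the section `L = Σ_i b_i L_i` of `B`. -/
noncomputable def secCoeff {n s : ℕ} (A : Fin s → Fin n → Cn n → ℂ)
    (b : Fin s → Cn n → ℂ) : Fin n → Cn n → ℂ :=
  fun j x => ∑ i, b i x * A i j x

/-- `min_L ν_B(λ(L,L))(p)` over smooth sections `L` of `B` with `L(p) ≠ 0`. -/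
noncomputable def minNuLevi {n s : ℕ} (ρ : Cn n → ℝ) (A : Fin s → Fin n → Cn n → ℂ)
    (p : Cn n) : ℕ∞ :=
  sInf {m : ℕ∞ | ∃ b : Fin s → Cn n → ℂ, (∀ i, ContDiff ℝ (⊤ : ℕ∞) (b i)) ∧
    (fun j => secCoeff A b j p) ≠ 0 ∧
    m = nuB A (levi ρ (secCoeff A b) (secCoeff A b)) p}

/-- The Levi-form type `c^{(s)}(B,p) = 2 + min_L ν_B(λ(L,L))(p)`. -/
noncomputable def cTypeB {n s : ℕ} (ρ : Cn n → ℝ) (A : Fin s → Fin n → Cn n → ℂ)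
    (p : Cn n) : ℕ∞ :=
  2 + minNuLevi ρ A p

/-- Iterated commutators of length `μ` of elements of `𝓜₁(B)`. -/
inductive IsCommOfB {n s : ℕ} (A : Fin s → Fin n → Cn n → ℂ) : ℕ → CVF n → Prop
  | one (W : CVF n) : InM1B A W → IsCommOfB A 1 W
  | succ {μ : ℕ} (V W : CVF n) : InM1B A V → IsCommOfB A μ W →
      IsCommOfB A (μ + 1) (V.bracket W)

/-- The commutator type `t^{(s)}(B,p)`: the smallest `m` such that `⟨∂ρ, G⟩(p) ≠ 0` for
some iterated commutator `G` of length (at most) `m` of elements of `𝓜₁(B)`; `⊤` if none. -/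
noncomputable def tTypeB {n s : ℕ} (ρ : Cn n → ℝ) (A : Fin s → Fin n → Cn n → ℂ)
    (p : Cn n) : ℕ∞ :=
  sInf {m : ℕ∞ | ∃ μ : ℕ, (μ : ℕ∞) = m ∧ ∃ G : CVF n, IsCommOfB A μ G ∧ pairDRho ρ G p ≠ 0}

/-- `A` is a smooth frame of a rank-`s` CR subbundle `B ⊆ T^{1,0}M`: each `L_i` is a smooth
CR vector field along `M` and the values `L₁(x), …, L_s(x)` are ℂ-linearly independent at
every point `x ∈ M`. -/
def IsCRFrame {n s : ℕ} (ρ : Cn n → ℝ) (M : Set (Cn n))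
    (A : Fin s → Fin n → Cn n → ℂ) : Prop :=
  (∀ i, IsCRField ρ M (A i)) ∧ ∀ x ∈ M, LinearIndependent ℂ (fun i => fun j => A i j x)

section Flow

open Set Filter Asymptotics Finset

variable {E : Type*} [NormedAddCommGroup E] [NormedSpace ℝ E]

/-- The smooth real-valued functions on a real normed space. -/
def smoothFun (E : Type*) [NormedAddCommGroup E] [NormedSpace ℝ E] : Submodule ℝ (E → ℝ) where
  carrier := {g | ContDiff ℝ (⊤ : ℕ∞) g}
  add_mem' {a b} ha hb := show ContDiff ℝ (⊤ : ℕ∞) (a + b) from ContDiff.add ha hb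
  zero_mem' := show ContDiff ℝ (⊤ : ℕ∞) (fun _ : E => (0 : ℝ)) from contDiff_const
  smul_mem' c g hg := show ContDiff ℝ (⊤ : ℕ∞) (c • g) from ContDiff.const_smul c hg

lemma contDiff_smoothFun (g : smoothFun E) : ContDiff ℝ (⊤ : ℕ∞) (g : E → ℝ) := g.2

lemma differentiable_smoothFun (g : smoothFun E) : Differentiable ℝ (g : E → ℝ) :=
  (contDiff_smoothFun g).differentiable (by simp)

lemma contDiff_fderiv_apply_field {F : Type*} [NormedAddCommGroup F] [NormedSpace ℝ F]
    {g : E → F} (hg : ContDiff ℝ (⊤ : ℕ∞) g) {X : E → E} (hX : ContDiff ℝ (⊤ : ℕ∞) X) :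
    ContDiff ℝ (⊤ : ℕ∞) (fun x => fderiv ℝ g x (X x)) :=
  (hg.fderiv_right (m := (⊤ : ℕ∞)) (by simp)).clm_apply hX

/-- The derivation of the smooth functions given by a smooth vector field. -/
noncomputable def lieDer (X : E → E) (hX : ContDiff ℝ (⊤ : ℕ∞) X) :
    Module.End ℝ (smoothFun E) where
  toFun g := ⟨fun x => fderiv ℝ (g : E → ℝ) x (X x),
    contDiff_fderiv_apply_field (contDiff_smoothFun g) hX⟩
  map_add' g h := by
    ext x
    simp [fderiv_add (differentiable_smoothFun g x) (differentiable_smoothFun h x)]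
  map_smul' c g := by
    ext x
    simp [fderiv_const_smul (differentiable_smoothFun g x) c]

@[simp] lemma lieDer_apply (X : E → E) (hX : ContDiff ℝ (⊤ : ℕ∞) X) (g : smoothFun E) (x : E) :
    (lieDer X hX g : E → ℝ) x = fderiv ℝ (g : E → ℝ) x (X x) := rfl

/-- The flow of a `C¹` vector field near a point, jointly continuous at that point. -/
lemma exists_continuousAt_local_flow [CompleteSpace E] {X : E → E} {p : E}
    (hX : ContDiffAt ℝ 1 X p) :
    ∃ φ : ℝ × E → E, ∃ δ > 0, ContinuousAt φ (0, p) ∧ ∀ x ∈ Metric.ball p δ, φ (0, x) = x ∧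
      ∀ t ∈ Metric.ball (0 : ℝ) δ, HasDerivAt (fun s => φ (s, x)) (X (φ (t, x))) t := by
  obtain ⟨ε, hε, a, r, L, K, hr, hpl⟩ := IsPicardLindelof.of_contDiffAt_one hX
  obtain ⟨α, hα, hc⟩ :=
    (hpl 0).exists_forall_mem_closedBall_eq_hasDerivWithinAt_continuousOn
  refine ⟨fun q => α (q.2, q.1), min ε r, lt_min hε hr, ?_, fun x hx => ?_⟩
  · have h1 : ContinuousAt α (p, 0) := by
      refine hc.continuousAt (prod_mem_nhds (Metric.closedBall_mem_nhds p hr) ?_)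
      exact Icc_mem_nhds (by simpa using hε) (by simpa using hε)
    exact ContinuousAt.comp (f := fun q : ℝ × E => (q.2, q.1)) (x := ((0 : ℝ), p)) h1
      (by fun_prop)
  · have hx' : x ∈ Metric.closedBall p r :=
      Metric.mem_closedBall.2 ((Metric.mem_ball.1 hx).le.trans (min_le_right _ _))
    refine ⟨(hα x hx').1, fun t ht => ?_⟩
    rw [Metric.mem_ball, Real.dist_eq, sub_zero, abs_lt] at ht
    have h1 := min_le_left ε r
    exact ((hα x hx').2 t ⟨by linarith, by linarith⟩).hasDerivAt
      (Icc_mem_nhds (by linarith) (by linarith))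

/-- A smooth vector field tangent to a regular level set has a local flow preserving it. -/
lemma exists_local_flow_of_tangent [CompleteSpace E] {ρ : E → ℝ} (hρ : ContDiff ℝ (⊤ : ℕ∞) ρ)
    {X : E → E} (hX : ContDiff ℝ (⊤ : ℕ∞) X) (hT : ∀ x, ρ x = 0 → fderiv ℝ ρ x (X x) = 0)
    {p : E} (hreg : fderiv ℝ ρ p ≠ 0) :
    ∃ φ : ℝ × E → E, Tendsto φ (𝓝 0 ×ˢ 𝓝[{x | ρ x = 0}] p) (𝓝[{x | ρ x = 0}] p) ∧
      ∃ δ > 0, ∀ x ∈ Metric.ball p δ, ρ x = 0 → φ (0, x) = x ∧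
      ∀ t ∈ Metric.ball (0 : ℝ) δ, HasDerivAt (fun s => φ (s, x)) (X (φ (t, x))) t := by
  obtain ⟨v, hv⟩ : ∃ v, fderiv ℝ ρ p v ≠ 0 := by
    by_contra! h
    exact hreg (ContinuousLinearMap.ext h)
  have hρX := contDiff_fderiv_apply_field hρ hX
  have hρv : ContDiff ℝ (⊤ : ℕ∞) (fun x => fderiv ℝ ρ x v) :=
    contDiff_fderiv_apply_field hρ contDiff_const
  set Y : E → E := fun x => X x - (fderiv ℝ ρ x (X x) / fderiv ℝ ρ x v) • v with hY
  have hYX : ∀ x, ρ x = 0 → Y x = X x := fun x hx => by simp [hY, hT x hx]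
  have hYρ : ∀ x, fderiv ℝ ρ x v ≠ 0 → fderiv ℝ ρ x (Y x) = 0 := fun x hx => by
    simp [hY, div_mul_cancel₀ _ hx]
  have hYd : ContDiffAt ℝ 1 Y p := by
    have h1 : ContDiffAt ℝ 1 (fun x => fderiv ℝ ρ x (X x) / fderiv ℝ ρ x v) p :=
      (hρX.contDiffAt.of_le (by simp)).div (hρv.contDiffAt.of_le (by simp)) hv
    exact (hX.contDiffAt.of_le (by simp)).sub (h1.smul contDiffAt_const)
  obtain ⟨φ, δ, hδ, hc, hφ⟩ := exists_continuousAt_local_flow hYd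
  have hφp : φ (0, p) = p := (hφ p (Metric.mem_ball_self hδ)).1
  have hev : ∀ᶠ q in 𝓝 ((0 : ℝ), p), fderiv ℝ ρ (φ q) v ≠ 0 := by
    have : ContinuousAt (fun q => fderiv ℝ ρ (φ q) v) ((0 : ℝ), p) :=
      ContinuousAt.comp (g := fun x => fderiv ℝ ρ x v) hρv.continuous.continuousAt hc
    exact this.eventually_ne (by simpa [hφp] using hv)
  obtain ⟨δ', hδ', hball⟩ := Metric.eventually_nhds_iff_ball.1 hev
  have hδ₀ : 0 < min δ δ' := lt_min hδ hδ'
  have hM : ∀ x ∈ Metric.ball p (min δ δ'), ρ x = 0 →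
      ∀ t ∈ Metric.ball (0 : ℝ) (min δ δ'), ρ (φ (t, x)) = 0 := by
    intro x hx hx0 t ht
    have hd : ∀ s ∈ Metric.ball (0 : ℝ) (min δ δ'),
        HasDerivWithinAt (fun s => ρ (φ (s, x))) 0 (Metric.ball (0 : ℝ) (min δ δ')) s := by
      intro s hs
      have h1 := (hφ x (Metric.ball_subset_ball (min_le_left _ _) hx)).2 s
        (Metric.ball_subset_ball (min_le_left _ _) hs)
      have h2 : fderiv ℝ ρ (φ (s, x)) v ≠ 0 := by
        refine hball (s, x) ?_
        rw [← ball_prod_same]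
        exact ⟨Metric.ball_subset_ball (min_le_right _ _) hs,
          Metric.ball_subset_ball (min_le_right _ _) hx⟩
      have h3 := ((hρ.differentiable (by simp)) (φ (s, x))).hasFDerivAt.comp_hasDerivAt s h1
      rw [hYρ _ h2] at h3
      exact h3.hasDerivWithinAt
    have h4 := (convex_ball (0 : ℝ) (min δ δ')).norm_image_sub_le_of_norm_hasDerivWithin_le
      (C := 0) hd (by simp) (Metric.mem_ball_self hδ₀) ht
    have h5 := (hφ x (Metric.ball_subset_ball (min_le_left _ _) hx)).1
    simp only [zero_mul, norm_le_zero_iff, h5, hx0, sub_zero] at h4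
    exact h4
  refine ⟨φ, ?_, min δ δ', hδ₀, fun x hx hx0 => ⟨(hφ x
    (Metric.ball_subset_ball (min_le_left _ _) hx)).1, fun t ht => ?_⟩⟩
  · refine tendsto_nhdsWithin_iff.2 ⟨?_, ?_⟩
    · have : Tendsto φ (𝓝 (0, p)) (𝓝 p) := by simpa [ContinuousAt, hφp] using hc
      rw [nhds_prod_eq] at this
      exact this.mono_left (prod_mono le_rfl nhdsWithin_le_nhds)
    · have h1 : ∀ᶠ t in 𝓝 (0 : ℝ), t ∈ Metric.ball (0 : ℝ) (min δ δ') := Metric.ball_mem_nhds _ hδ₀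
      have h2 : ∀ᶠ x in 𝓝[{x | ρ x = 0}] p, x ∈ Metric.ball p (min δ δ') ∧ ρ x = 0 :=
        (eventually_nhdsWithin_of_eventually_nhds (Metric.ball_mem_nhds _ hδ₀)).and
          eventually_mem_nhdsWithin
      filter_upwards [h1.prod_mk h2] with q hq
      exact hM q.2 hq.2.1 hq.2.2 q.1 hq.1
  · rw [← hYX _ (hM x hx hx0 t ht)]
    exact (hφ x (Metric.ball_subset_ball (min_le_left _ _) hx)).2 t
      (Metric.ball_subset_ball (min_le_left _ _) ht)

/-- A family of maps `φ (t, ·)` acts on smooth functions near `p`, along `S`, as the formal power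
series `P` in `t` with operator coefficients, asymptotically as `t → 0`. -/
def HasExpansion (S : Set E) (p : E) (φ : ℝ × E → E)
    (P : PowerSeries (Module.End ℝ (smoothFun E))) : Prop :=
  Tendsto φ (𝓝 0 ×ˢ 𝓝[S] p) (𝓝[S] p) ∧ ∀ (N : ℕ) (g : smoothFun E),
    (fun q : ℝ × E => (g : E → ℝ) (φ q) -
      ∑ k ∈ range N, q.1 ^ k * (PowerSeries.coeff k P g : E → ℝ) q.2)
      =O[𝓝 0 ×ˢ 𝓝[S] p] fun q => q.1 ^ N

lemma HasExpansion.one (S : Set E) (p : E) : HasExpansion S p Prod.snd 1 := by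
  refine ⟨tendsto_snd, fun N g => ?_⟩
  rcases N with _ | N
  · have h : Tendsto (fun q : ℝ × E => (g : E → ℝ) q.2) (𝓝 0 ×ˢ 𝓝[S] p) (𝓝 ((g : E → ℝ) p)) :=
      ((contDiff_smoothFun g).continuous.continuousAt.mono_left nhdsWithin_le_nhds).comp tendsto_snd
    simpa using h.isBigO_one ℝ
  · refine (isBigO_zero _ _).congr_left fun q => ?_
    rw [Finset.sum_eq_single 0]
    · simp
    · intro k _ hk
      simp [PowerSeries.coeff_one, hk]
    · simp

lemma HasExpansion.mul {S : Set E} {p : E} {φ ψ : ℝ × E → E}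
    {P Q : PowerSeries (Module.End ℝ (smoothFun E))} (hP : HasExpansion S p φ P)
    (hQ : HasExpansion S p ψ Q) : HasExpansion S p (fun q => ψ (q.1, φ q)) (P * Q) := by
  have hφ : Tendsto (fun q : ℝ × E => (q.1, φ q)) (𝓝 0 ×ˢ 𝓝[S] p) (𝓝 0 ×ˢ 𝓝[S] p) :=
    tendsto_fst.prodMk hP.1
  refine ⟨hQ.1.comp hφ, fun N g => ?_⟩
  have h1 := (hQ.2 N g).comp_tendsto hφ
  have h2 : (fun q : ℝ × E => ∑ j ∈ range N, q.1 ^ j *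
      ((PowerSeries.coeff j Q g : E → ℝ) (φ q) - ∑ i ∈ range (N - j), q.1 ^ i *
        (PowerSeries.coeff i P (PowerSeries.coeff j Q g) : E → ℝ) q.2))
      =O[𝓝 0 ×ˢ 𝓝[S] p] fun q => q.1 ^ N := by
    refine IsBigO.fun_sum fun j hj => ?_
    refine ((isBigO_refl (fun q : ℝ × E => q.1 ^ j) _).mul
      (hP.2 (N - j) (PowerSeries.coeff j Q g))).congr_right fun q => ?_
    rw [← pow_add, Nat.add_sub_cancel' (Finset.mem_range.1 hj).le]
  refine (h1.add h2).congr_left fun q => ?_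
  have h3 : ∑ k ∈ range N, q.1 ^ k * (PowerSeries.coeff k (P * Q) g : E → ℝ) q.2 =
      ∑ j ∈ range N, ∑ i ∈ range (N - j), q.1 ^ j * (q.1 ^ i *
        (PowerSeries.coeff i P (PowerSeries.coeff j Q g) : E → ℝ) q.2) := by
    rw [← Finset.sum_range_diag_flip N fun j i => q.1 ^ j * (q.1 ^ i *
        (PowerSeries.coeff i P (PowerSeries.coeff j Q g) : E → ℝ) q.2)]
    refine Finset.sum_congr rfl fun k _ => ?_
    rw [PowerSeries.coeff_mul, ← Finset.Nat.sum_antidiagonal_swap,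
      Finset.Nat.sum_antidiagonal_eq_sum_range_succ_mk]
    simp only [LinearMap.sum_apply, Module.End.mul_apply, Submodule.coe_sum, Finset.sum_apply,
      Finset.mul_sum, Prod.swap]
    refine Finset.sum_congr rfl fun j hj => ?_
    rw [← mul_assoc, ← pow_add, Nat.add_sub_cancel' (Finset.mem_range_succ_iff.1 hj)]
  rw [h3]
  simp only [Function.comp_apply, mul_sub, Finset.sum_sub_distrib, Finset.mul_sum]
  ring

/-- The formal exponential `∑ tᵏ Dᵏ / k!` of an operator. -/
noncomputable def expSeries {A : Type*} [Ring A] [Algebra ℝ A] (D : A) : PowerSeries A :=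
  PowerSeries.mk fun k => ((k.factorial : ℝ)⁻¹) • D ^ k

lemma exists_hasExpansion_expSeries [CompleteSpace E] {ρ : E → ℝ} (hρ : ContDiff ℝ (⊤ : ℕ∞) ρ)
    {X : E → E} (hX : ContDiff ℝ (⊤ : ℕ∞) X) (hT : ∀ x, ρ x = 0 → fderiv ℝ ρ x (X x) = 0)
    {p : E} (hreg : fderiv ℝ ρ p ≠ 0) :
    ∃ φ, HasExpansion {x | ρ x = 0} p φ (expSeries (lieDer X hX)) := by
  obtain ⟨φ, hφ, δ, hδ, hflow⟩ := exists_local_flow_of_tangent hρ hX hT hreg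
  refine ⟨φ, hφ, fun N => ?_⟩
  induction N with
  | zero =>
    intro g
    have h : Tendsto (fun q : ℝ × E => (g : E → ℝ) (φ q)) (𝓝 0 ×ˢ 𝓝[{x | ρ x = 0}] p)
        (𝓝 ((g : E → ℝ) p)) :=
      ((contDiff_smoothFun g).continuous.continuousAt.mono_left nhdsWithin_le_nhds).comp hφ
    simpa using h.isBigO_one ℝ
  | succ N ih =>
    intro g
    set D := lieDer X hX with hD
    obtain ⟨C, hC⟩ := (ih (D g)).bound
    have hbasis := (Metric.nhds_basis_ball (x := (0 : ℝ))).prod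
      (Metric.nhdsWithin_basis_ball (x := p) (s := {x | ρ x = 0}))
    obtain ⟨⟨a, b⟩, ⟨ha, hb⟩, hab⟩ := hbasis.eventually_iff.1 hC
    refine IsBigO.of_bound |C| ?_
    refine hbasis.eventually_iff.2 ⟨(min a δ, min b δ), ⟨lt_min ha hδ, lt_min hb hδ⟩, ?_⟩
    rintro ⟨t, x⟩ ⟨ht, hx, hx0⟩
    obtain ⟨hx1, hx2⟩ := hflow x (Metric.ball_subset_ball (min_le_right _ _) hx) hx0
    have hmem : ∀ s ∈ uIcc 0 t, |s| ≤ |t| := fun s hs => by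
      simpa using abs_sub_left_of_mem_uIcc hs
    have ht' : |t| < min a δ := by simpa using ht
    set H : ℝ → ℝ := fun s => (g : E → ℝ) (φ (s, x)) -
      ∑ k ∈ range (N + 1), s ^ k * (PowerSeries.coeff k (expSeries D) g : E → ℝ) x with hH
    have hder : ∀ s ∈ uIcc 0 t, HasDerivWithinAt H
        ((D g : E → ℝ) (φ (s, x)) - ∑ k ∈ range N,
          s ^ k * (PowerSeries.coeff k (expSeries D) (D g) : E → ℝ) x) (uIcc 0 t) s := by
      intro s hs
      have h1 := hx2 s (by
        have := (hmem s hs).trans_lt (ht'.trans_le (min_le_right _ _))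
        simpa using this)
      have h2 := (differentiable_smoothFun g (φ (s, x))).hasFDerivAt.comp_hasDerivAt s h1
      have h3 : HasDerivAt (fun s : ℝ => ∑ k ∈ range (N + 1),
          s ^ k * (PowerSeries.coeff k (expSeries D) g : E → ℝ) x)
          (∑ k ∈ range (N + 1), ((k : ℝ) * s ^ (k - 1)) *
            (PowerSeries.coeff k (expSeries D) g : E → ℝ) x) s :=
        HasDerivAt.fun_sum fun k _ => (hasDerivAt_pow k s).mul_const _
      have h4 := (h2.sub h3).hasDerivWithinAt (s := uIcc 0 t)
      refine h4.congr_deriv ?_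
      congr 1
      rw [Finset.sum_range_succ']
      simp only [Nat.cast_zero, zero_mul, add_zero, Nat.add_sub_cancel]
      refine Finset.sum_congr rfl fun k _ => ?_
      simp only [expSeries, PowerSeries.coeff_mk, LinearMap.smul_apply, Submodule.coe_smul,
        Pi.smul_apply, smul_eq_mul, pow_succ, Module.End.mul_apply, Nat.factorial_succ]
      push_cast
      have : (k.factorial : ℝ) ≠ 0 := by positivity
      have : (k + 1 : ℝ) ≠ 0 := by positivity
      field_simp
    have hbound : ∀ s ∈ uIcc 0 t, ‖(D g : E → ℝ) (φ (s, x)) - ∑ k ∈ range N,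
          s ^ k * (PowerSeries.coeff k (expSeries D) (D g) : E → ℝ) x‖ ≤ |C| * |t| ^ N := by
      intro s hs
      have h1 := hab (x := (s, x)) ⟨by
        have := (hmem s hs).trans_lt (ht'.trans_le (min_le_left _ _))
        simpa using this, Metric.ball_subset_ball (min_le_left _ _) hx, hx0⟩
      refine h1.trans ?_
      rw [norm_pow, Real.norm_eq_abs]
      have h2 := hmem s hs
      have h3 := le_abs_self C
      gcongr
    have hfin := (convex_uIcc 0 t).norm_image_sub_le_of_norm_hasDerivWithin_le hder hbound
      left_mem_uIcc right_mem_uIcc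
    have hH0 : H 0 = 0 := by
      simp [hH, hx1, Finset.sum_range_succ', expSeries]
    rw [hH0, sub_zero, sub_zero] at hfin
    refine hfin.trans_eq ?_
    rw [norm_pow, Real.norm_eq_abs, pow_succ]
    ring

section Parity

variable {A : Type*} [Ring A] [Algebra ℝ A]

lemma coeff_prod_map_expSeries_mem (s : Set A) (l : List A) (hl : ∀ D ∈ l, D ∈ s) (k : ℕ) :
    PowerSeries.coeff k (l.map expSeries).prod ∈ Submodule.span ℝ s ^ k := by
  induction l generalizing k with
  | nil =>
    rcases k with _ | k
    · simpa using Submodule.one_le.1 (le_refl (1 : Submodule ℝ A))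
    · simp [PowerSeries.coeff_one]
  | cons D l ih =>
    rw [List.map_cons, List.prod_cons, PowerSeries.coeff_mul]
    refine Submodule.sum_mem _ fun ij hij => ?_
    rw [← Finset.HasAntidiagonal.mem_antidiagonal.1 hij, pow_add]
    refine Submodule.mul_mem_mul ?_ (ih (fun D' h => hl D' (List.mem_cons_of_mem _ h)) _)
    rw [expSeries, PowerSeries.coeff_mk]
    exact Submodule.smul_mem _ _ (Submodule.pow_mem_pow _
      (Submodule.subset_span (hl D List.mem_cons_self)) _)

lemma coeff_prod_map_expSeries_sub_one (l : List A) :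
    (∀ k < l.length, PowerSeries.coeff k (l.map fun D => expSeries D - 1).prod = 0) ∧
      PowerSeries.coeff l.length (l.map fun D => expSeries D - 1).prod = l.prod := by
  induction l with
  | nil => simp
  | cons D l ih =>
    have h0 : PowerSeries.coeff 0 (expSeries D - 1) = 0 := by simp [expSeries]
    have h1 : PowerSeries.coeff 1 (expSeries D - 1) = D := by
      simp [expSeries, PowerSeries.coeff_one]
    refine ⟨fun k hk => ?_, ?_⟩
    · rw [List.map_cons, List.prod_cons, PowerSeries.coeff_mul]
      refine Finset.sum_eq_zero fun ij hij => ?_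
      rw [Finset.HasAntidiagonal.mem_antidiagonal] at hij
      rcases Nat.eq_zero_or_pos ij.1 with h | h
      · rw [h, h0, zero_mul]
      · rw [ih.1 ij.2 (by rw [List.length_cons] at hk; omega), mul_zero]
    · rw [List.map_cons, List.prod_cons, PowerSeries.coeff_mul, List.length_cons,
        Finset.sum_eq_single (1, l.length), h1, ih.2, List.prod_cons]
      · intro ij hij hne
        rw [Finset.HasAntidiagonal.mem_antidiagonal] at hij
        rcases Nat.eq_zero_or_pos ij.1 with h | h
        · rw [h, h0, zero_mul]
        · rw [ih.1 ij.2, mul_zero]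
          by_contra hlt
          exact hne (Prod.ext (by simp only; omega) (by simp only; omega))
      · intro h
        exact absurd (Finset.HasAntidiagonal.mem_antidiagonal.2 (add_comm _ _)) h

lemma map_prod_expSeries_sub_one_eq_zero {s : Set A} (Φ : PowerSeries A →+ ℝ)
    (hΦ : ∀ l : List A, (∀ D ∈ l, D ∈ s) → Φ (l.map expSeries).prod = 0) (l : List A) :
    ∀ l' : List A, (∀ D ∈ l', D ∈ s) → (∀ D ∈ l, D ∈ s) →
      Φ ((l'.map expSeries).prod * (l.map fun D => expSeries D - 1).prod) = 0 := by
  induction l with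
  | nil => intro l' hl' _; simpa using hΦ l' hl'
  | cons D l ih =>
    intro l' hl' hl
    have hl₀ : ∀ D' ∈ l, D' ∈ s := fun D' h => hl D' (List.mem_cons_of_mem _ h)
    have h1 := ih (l' ++ [D]) (by
      intro D' h
      rcases List.mem_append.1 h with h | h
      · exact hl' D' h
      · rw [List.mem_singleton.1 h]
        exact hl D List.mem_cons_self) hl₀
    have h2 := ih l' hl' hl₀
    simp only [List.map_append, List.map_cons, List.map_nil, List.prod_append, List.prod_cons,
      List.prod_nil, mul_one] at h1
    rw [List.map_cons, List.prod_cons, sub_mul, one_mul, mul_sub, map_sub, h2, ← mul_assoc, h1,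
      sub_zero]

lemma HasExpansion.exists_list_prod {S : Set E} {p : E} {s : Set (Module.End ℝ (smoothFun E))}
    (hs : ∀ D ∈ s, ∃ φ, HasExpansion S p φ (expSeries D))
    (l : List (Module.End ℝ (smoothFun E))) (hl : ∀ D ∈ l, D ∈ s) :
    ∃ φ, HasExpansion S p φ (l.map expSeries).prod := by
  induction l with
  | nil => exact ⟨_, HasExpansion.one S p⟩
  | cons D l ih =>
    obtain ⟨φ, hφ⟩ := hs D (hl D List.mem_cons_self)
    obtain ⟨ψ, hψ⟩ := ih fun D' h => hl D' (List.mem_cons_of_mem _ h)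
    exact ⟨_, hφ.mul hψ⟩

/-- The leading coefficient of odd order in the expansion of a nonnegative function vanishes. -/
lemma HasExpansion.coeff_eq_zero_of_odd {S : Set E} {p : E} (hp : p ∈ S) {φ : ℝ × E → E}
    {P : PowerSeries (Module.End ℝ (smoothFun E))} (hP : HasExpansion S p φ P)
    (g : smoothFun E) (hg : ∀ᶠ x in 𝓝[S] p, 0 ≤ (g : E → ℝ) x) {m : ℕ} (hm : Odd m)
    (hlow : ∀ k < m, (PowerSeries.coeff k P g : E → ℝ) p = 0) :
    (PowerSeries.coeff m P g : E → ℝ) p = 0 := by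
  set c := (PowerSeries.coeff m P g : E → ℝ) p
  have hι : Tendsto (fun t : ℝ => (t, p)) (𝓝 0) (𝓝 0 ×ˢ 𝓝[S] p) :=
    tendsto_id.prodMk (tendsto_const_pure.mono_right (pure_le_nhdsWithin hp))
  have h1 : (fun t : ℝ => (g : E → ℝ) (φ (t, p)) - t ^ m * c) =O[𝓝 0] fun t => t ^ (m + 1) := by
    refine ((hP.2 (m + 1) g).comp_tendsto hι).congr_left fun t => ?_
    simp only [Function.comp_apply]
    rw [Finset.sum_range_succ, Finset.sum_eq_zero, zero_add]
    intro k hk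
    rw [hlow k (Finset.mem_range.1 hk), mul_zero]
  have h2 : ∀ᶠ t : ℝ in 𝓝 0, 0 ≤ (g : E → ℝ) (φ (t, p)) := (hP.1.comp hι).eventually hg
  have h3 : (fun t : ℝ => (g : E → ℝ) (φ (t, p)) - t ^ m * c) =o[𝓝 0] fun t => t ^ m :=
    h1.trans_isLittleO (isLittleO_pow_pow m.lt_succ_self)
  by_contra hne
  have h4 := (h3.bound (half_pos (abs_pos.2 hne))).and h2
  have h5 : ∀ᶠ t : ℝ in 𝓝 0, (|(g : E → ℝ) (φ (-t, p)) - (-t) ^ m * c| ≤ |c| / 2 * |t| ^ m) ∧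
      0 ≤ (g : E → ℝ) (φ (-t, p)) := by
    have := (continuous_neg.tendsto' (0 : ℝ) 0 neg_zero).eventually h4
    simpa using this
  obtain ⟨t, ⟨⟨h6, h7⟩, h8, h9⟩, ht⟩ :=
    (((h4.and h5).filter_mono (nhdsWithin_le_nhds (s := Ioi 0))).and self_mem_nhdsWithin).exists
  have ht' : 0 < t := ht
  have htm : 0 < t ^ m := pow_pos ht' m
  rw [hm.neg_pow] at h8
  rw [norm_pow, Real.norm_eq_abs, Real.norm_eq_abs, abs_of_pos ht', abs_le] at h6
  rw [abs_of_pos ht', abs_le] at h8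
  rcases lt_or_gt_of_ne hne with h | h
  · rw [abs_of_neg h] at h6
    nlinarith
  · rw [abs_of_pos h] at h8
    nlinarith

/-- If all words of length less than `m` annihilate a nonnegative function at `p` and `m` is odd,
then so do the words of length `m`. -/
lemma apply_eq_zero_of_odd {S : Set E} {p : E} (hp : p ∈ S)
    {s : Set (Module.End ℝ (smoothFun E))}
    (hs : ∀ D ∈ s, ∃ φ, HasExpansion S p φ (expSeries D))
    (g : smoothFun E) (hg : ∀ᶠ x in 𝓝[S] p, 0 ≤ (g : E → ℝ) x) {m : ℕ} (hm : Odd m)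
    (hlow : ∀ k < m, ∀ w ∈ Submodule.span ℝ s ^ k, (w g : E → ℝ) p = 0)
    (w : Module.End ℝ (smoothFun E)) (hw : w ∈ Submodule.span ℝ s ^ m) :
    (w g : E → ℝ) p = 0 := by
  let Φ : PowerSeries (Module.End ℝ (smoothFun E)) →+ ℝ :=
    { toFun := fun P => (PowerSeries.coeff m P g : E → ℝ) p
      map_zero' := by simp
      map_add' := fun P Q => by simp }
  have hΦ : ∀ l : List (Module.End ℝ (smoothFun E)), (∀ D ∈ l, D ∈ s) →
      Φ (l.map expSeries).prod = 0 := fun l hl => by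
    obtain ⟨φ, hφ⟩ := HasExpansion.exists_list_prod hs l hl
    exact hφ.coeff_eq_zero_of_odd hp g hg hm fun k hk =>
      hlow k hk _ (coeff_prod_map_expSeries_mem s l hl k)
  rw [Submodule.span_pow] at hw
  induction hw using Submodule.span_induction with
  | mem w hw =>
    obtain ⟨u, rfl⟩ := Set.mem_pow.1 hw
    have h1 := map_prod_expSeries_sub_one_eq_zero Φ hΦ (List.ofFn fun i =>
      (u i : Module.End ℝ (smoothFun E))) []
      (by simp) (by
        intro D hD
        obtain ⟨i, rfl⟩ := List.mem_ofFn.1 hD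
        exact (u i).2)
    have h2 := (coeff_prod_map_expSeries_sub_one (List.ofFn fun i => (u i :
      Module.End ℝ (smoothFun E)))).2
    rw [List.length_ofFn] at h2
    rw [← h2]
    simpa [Φ] using h1
  | zero => simp
  | add x y _ _ hx hy => simp [hx, hy]
  | smul c x _ hx => simp [hx]

end Parity

end Flow

section WirtingerFields

open Set Filter Asymptotics

variable {n s : ℕ}

lemma clm_apply_eq_sum_re_im {F : Type*} [NormedAddCommGroup F] [NormedSpace ℝ F]
    (T : Cn n →L[ℝ] F) (u : Cn n) :
    T u = ∑ j, ((u j).re • T (Pi.single j 1) + (u j).im • T (Pi.single j Complex.I)) := by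
  have h : u = ∑ j, ((u j).re • (Pi.single j (1 : ℂ) : Cn n) +
      (u j).im • (Pi.single j Complex.I : Cn n)) := by
    conv_lhs => rw [← Finset.univ_sum_single u]
    refine Finset.sum_congr rfl fun j _ => ?_
    rw [← Pi.single_smul, ← Pi.single_smul, ← Pi.single_add]
    congr 1
    apply Complex.ext <;> simp
  conv_lhs => rw [h]
  simp [map_sum]

lemma fderiv_ofReal_add_I_mul_ofReal (g h : smoothFun (Cn n)) (x v : Cn n) :
    fderiv ℝ (fun y => ((g : Cn n → ℝ) y : ℂ) + Complex.I * ((h : Cn n → ℝ) y : ℂ)) x v =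
      (fderiv ℝ (g : Cn n → ℝ) x v : ℂ) + Complex.I * (fderiv ℝ (h : Cn n → ℝ) x v : ℂ) := by
  have hg := Complex.ofRealCLM.hasFDerivAt.comp x (differentiable_smoothFun g x).hasFDerivAt
  have hh := Complex.ofRealCLM.hasFDerivAt.comp x (differentiable_smoothFun h x).hasFDerivAt
  have h1 : HasFDerivAt
      (fun y => ((g : Cn n → ℝ) y : ℂ) + Complex.I * ((h : Cn n → ℝ) y : ℂ)) _ x :=
    hg.add (hh.const_mul Complex.I)
  rw [h1.fderiv]
  simp

lemma CVF.act_eq_of_decomposition (W : CVF n) (g h : smoothFun (Cn n)) (x u v : Cn n)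
    (hu : ∀ j, u j = (W.hol j x + starRingEnd ℂ (W.anti j x)) / 2)
    (hv : ∀ j, v j = -Complex.I * (W.hol j x - starRingEnd ℂ (W.anti j x)) / 2) :
    W.act (fun y => ((g : Cn n → ℝ) y : ℂ) + Complex.I * ((h : Cn n → ℝ) y : ℂ)) x =
      ((fderiv ℝ (g : Cn n → ℝ) x u - fderiv ℝ (h : Cn n → ℝ) x v : ℝ) : ℂ) +
      Complex.I * ((fderiv ℝ (h : Cn n → ℝ) x u + fderiv ℝ (g : Cn n → ℝ) x v : ℝ) : ℂ) := by
  simp only [CVF.act, wz, wzb, fderiv_ofReal_add_I_mul_ofReal]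
  rw [clm_apply_eq_sum_re_im (fderiv ℝ (g : Cn n → ℝ) x) u,
    clm_apply_eq_sum_re_im (fderiv ℝ (g : Cn n → ℝ) x) v,
    clm_apply_eq_sum_re_im (fderiv ℝ (h : Cn n → ℝ) x) u,
    clm_apply_eq_sum_re_im (fderiv ℝ (h : Cn n → ℝ) x) v]
  simp only [← Finset.sum_add_distrib, ← Finset.sum_sub_distrib, Complex.ofReal_sum,
    Finset.mul_sum]
  refine Finset.sum_congr rfl fun j _ => ?_
  rw [hu, hv]
  apply Complex.ext <;> simp <;> ring

/-- The real vector field with complex coordinates `∑ i, e i * A i`, that is, twice the real part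
of the section of the bundle spanned by the frame `A` with coefficients `e`. -/
def realField (A : Fin s → Fin n → Cn n → ℂ) (e : Fin s → Cn n → ℂ) : Cn n → Cn n :=
  fun x j => ∑ i, e i x * A i j x

lemma contDiff_realField {A : Fin s → Fin n → Cn n → ℂ}
    (hA : ∀ i j, ContDiff ℝ (⊤ : ℕ∞) (A i j)) {e : Fin s → Cn n → ℂ}
    (he : ∀ i, ContDiff ℝ (⊤ : ℕ∞) (e i)) : ContDiff ℝ (⊤ : ℕ∞) (realField A e) :=
  contDiff_pi.2 fun j => ContDiff.sum fun i _ => (he i).mul (hA i j)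

/-- The derivations of the smooth functions given by the real sections of `B ⊕ B̄`. -/
def realDerivations (A : Fin s → Fin n → Cn n → ℂ) : Set (Module.End ℝ (smoothFun (Cn n))) :=
  {D | ∃ e : Fin s → Cn n → ℂ, (∀ i, ContDiff ℝ (⊤ : ℕ∞) (e i)) ∧
    ∃ hX : ContDiff ℝ (⊤ : ℕ∞) (realField A e), D = lieDer (realField A e) hX}

lemma InM1B.exists_realDerivations {A : Fin s → Fin n → Cn n → ℂ}
    (hA : ∀ i j, ContDiff ℝ (⊤ : ℕ∞) (A i j)) {W : CVF n} (hW : InM1B A W) :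
    ∃ D₁ ∈ realDerivations A, ∃ D₂ ∈ realDerivations A, ∀ g h : smoothFun (Cn n),
      W.act (fun y => ((g : Cn n → ℝ) y : ℂ) + Complex.I * ((h : Cn n → ℝ) y : ℂ)) =
        fun y => ((D₁ g - D₂ h : smoothFun (Cn n)) : Cn n → ℝ) y +
          Complex.I * (((D₁ h + D₂ g : smoothFun (Cn n)) : Cn n → ℝ) y : ℂ) := by
  obtain ⟨c, d, hc, hd, hhol, hanti⟩ := hW
  have hd' : ∀ i, ContDiff ℝ (⊤ : ℕ∞) fun x => starRingEnd ℂ (d i x) := fun i =>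
    Complex.conjCLE.contDiff.comp (hd i)
  have h1 : ∀ i, ContDiff ℝ (⊤ : ℕ∞) fun x => (c i x + starRingEnd ℂ (d i x)) / 2 := fun i =>
    ((hc i).add (hd' i)).div_const 2
  have h2 : ∀ i, ContDiff ℝ (⊤ : ℕ∞) fun x => -Complex.I * (c i x - starRingEnd ℂ (d i x)) / 2 :=
    fun i => (contDiff_const.mul ((hc i).sub (hd' i))).div_const 2
  refine ⟨_, ⟨_, h1, contDiff_realField hA h1, rfl⟩, _, ⟨_, h2, contDiff_realField hA h2, rfl⟩,
    fun g h => funext fun x => ?_⟩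
  refine CVF.act_eq_of_decomposition W g h x _ _ (fun j => ?_) fun j => ?_
  · rw [hhol, hanti, realField, map_sum, ← Finset.sum_add_distrib, Finset.sum_div]
    refine Finset.sum_congr rfl fun i _ => ?_
    simp only [map_mul, Complex.conj_conj]
    ring
  · rw [hhol, hanti, realField, map_sum, ← Finset.sum_sub_distrib, Finset.mul_sum, Finset.sum_div]
    refine Finset.sum_congr rfl fun i _ => ?_
    simp only [map_mul, Complex.conj_conj]
    ring

lemma exists_inM1B_act_cx {A : Fin s → Fin n → Cn n → ℂ} {D : Module.End ℝ (smoothFun (Cn n))}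
    (hD : D ∈ realDerivations A) :
    ∃ W, InM1B A W ∧ ∀ g : smoothFun (Cn n), W.act (cx (g : Cn n → ℝ)) = cx (D g : Cn n → ℝ) := by
  obtain ⟨e, he, hX, rfl⟩ := hD
  refine ⟨⟨fun j x => realField A e x j, fun j x => starRingEnd ℂ (realField A e x j)⟩,
    ⟨e, fun i x => starRingEnd ℂ (e i x), he, fun i => Complex.conjCLE.contDiff.comp (he i),
      fun j x => rfl, fun j x => by simp [realField]⟩, fun g => funext fun x => ?_⟩
  have h := CVF.act_eq_of_decomposition
    ⟨fun j x => realField A e x j, fun j x => starRingEnd ℂ (realField A e x j)⟩ g 0 x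
    (realField A e x) 0 (fun j => by simp) (fun j => by simp)
  have hcx : cx (g : Cn n → ℝ) = fun y => ((g : Cn n → ℝ) y : ℂ) := rfl
  rw [hcx]
  simpa [cx] using h

lemma fderiv_realField_eq_zero {ρ : Cn n → ℝ} (hρ : ContDiff ℝ (⊤ : ℕ∞) ρ) {M : Set (Cn n)}
    {A : Fin s → Fin n → Cn n → ℂ} (hA : ∀ i, IsCRField ρ M (A i)) (e : Fin s → Cn n → ℂ)
    {x : Cn n} (hx : x ∈ M) : fderiv ℝ ρ x (realField A e x) = 0 := by
  have h1 : ∑ j, realField A e x j * wz j (cx ρ) x = 0 := by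
    simp only [realField, Finset.sum_mul]
    rw [Finset.sum_comm]
    refine Finset.sum_eq_zero fun i _ => ?_
    simp only [mul_assoc]
    rw [← Finset.mul_sum, (hA i).2 x hx, mul_zero]
  have h2 : ∀ v, fderiv ℝ (cx ρ) x v = (fderiv ℝ ρ x v : ℂ) := fun v => by
    have := fderiv_ofReal_add_I_mul_ofReal ⟨ρ, hρ⟩ 0 x v
    have hcx : cx ρ = fun y => (ρ y : ℂ) := rfl
    rw [hcx]
    simpa using this
  have h3 := congrArg Complex.re h1
  rw [clm_apply_eq_sum_re_im]
  simp only [wz, h2, Complex.re_sum, Complex.zero_re] at h3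
  rw [← mul_zero (2 : ℝ), ← h3, Finset.mul_sum]
  refine Finset.sum_congr rfl fun j _ => ?_
  simp
  ring

lemma foldl_act_eq_zero_s7 {A : Fin s → Fin n → Cn n → ℂ}
    (hA : ∀ i j, ContDiff ℝ (⊤ : ℕ∞) (A i j)) (p : Cn n) (Ws : List (CVF n))
    (hWs : ∀ W ∈ Ws, InM1B A W) (g h : smoothFun (Cn n))
    (hgh : ∀ w ∈ Submodule.span ℝ (realDerivations A) ^ Ws.length,
      (w g : Cn n → ℝ) p = 0 ∧ (w h : Cn n → ℝ) p = 0) :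
    Ws.foldl (fun g W => W.act g)
      (fun y => ((g : Cn n → ℝ) y : ℂ) + Complex.I * ((h : Cn n → ℝ) y : ℂ)) p = 0 := by
  induction Ws generalizing g h with
  | nil =>
    have h0 := hgh 1 (by rw [List.length_nil, pow_zero]; exact Submodule.one_le.1 le_rfl)
    rw [Module.End.one_apply, Module.End.one_apply] at h0
    simp [h0.1, h0.2]
  | cons W Ws ih =>
    obtain ⟨D₁, h₁, D₂, h₂, hact⟩ := (hWs W List.mem_cons_self).exists_realDerivations hA
    rw [List.foldl_cons, hact]
    refine ih (fun W' h' => hWs W' (List.mem_cons_of_mem _ h')) _ _ fun w hw => ?_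
    have h3 := hgh (w * D₁) (by
      rw [List.length_cons, pow_succ]
      exact Submodule.mul_mem_mul hw (Submodule.subset_span h₁))
    have h4 := hgh (w * D₂) (by
      rw [List.length_cons, pow_succ]
      exact Submodule.mul_mem_mul hw (Submodule.subset_span h₂))
    simp only [Module.End.mul_apply] at h3 h4
    simp [h3, h4]

lemma apply_eq_zero_of_foldl_act {A : Fin s → Fin n → Cn n → ℂ} (p : Cn n) (k : ℕ)
    (g : smoothFun (Cn n))
    (hg : ∀ Ws : List (CVF n), Ws.length = k → (∀ W ∈ Ws, InM1B A W) →
      Ws.foldl (fun g W => W.act g) (cx (g : Cn n → ℝ)) p = 0)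
    (w : Module.End ℝ (smoothFun (Cn n)))
    (hw : w ∈ Submodule.span ℝ (realDerivations A) ^ k) : (w g : Cn n → ℝ) p = 0 := by
  induction k generalizing g w with
  | zero =>
    have h0 : (g : Cn n → ℝ) p = 0 := by simpa [cx] using hg [] rfl (by simp)
    rw [pow_zero] at hw
    obtain ⟨c, rfl⟩ := Submodule.mem_one.1 hw
    simp [Module.algebraMap_end_apply, h0]
  | succ k ih =>
    rw [pow_succ] at hw
    refine Submodule.mul_induction_on hw (fun w hw d hd => ?_) fun x y hx hy => by simp [hx, hy]
    induction hd using Submodule.span_induction with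
    | mem D hD =>
      obtain ⟨W, hW, hact⟩ := exists_inM1B_act_cx hD
      refine ih (D g) (fun Ws hlen hWs => ?_) w hw
      have := hg (W :: Ws) (by simp [hlen]) (by simpa using ⟨hW, hWs⟩)
      rwa [List.foldl_cons, hact] at this
    | zero => simp
    | add x y _ _ hx hy => simp_all [mul_add]
    | smul c x _ hx => simp_all

end WirtingerFields

/-- Let `M ⊂ ℂⁿ` (`n ≥ 2`) be a smooth real hypersurface and
`L₁, …, L_s` pointwise ℂ-linearly independent smooth CR vector fields spanning a rank-`s`
subbundle `B` of `T^{1,0}M`. If `f` is a germ of a real-valued smooth function on `M` at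
`p ∈ M` with `f ≥ 0` near `p`, then `ν_B(f)(p)` is an even number or infinite. -/
theorem nuB_even {n s : ℕ} (hn : 2 ≤ n) (ρ : Cn n → ℝ) (hρ : ContDiff ℝ (⊤ : ℕ∞) ρ)
    (M : Set (Cn n)) (hM : M = {x | ρ x = 0}) (hreg : ∀ x ∈ M, fderiv ℝ ρ x ≠ 0)
    (A : Fin s → Fin n → Cn n → ℂ) (hA : IsCRFrame ρ M A)
    (p : Cn n) (hp : p ∈ M)
    (f : Cn n → ℝ) (hf : ContDiff ℝ (⊤ : ℕ∞) f)
    (hpos : ∀ᶠ x in nhds p, x ∈ M → 0 ≤ f x) :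
    (∃ k : ℕ, nuB A (cx f) p = 2 * (k : ℕ∞)) ∨ nuB A (cx f) p = ⊤ := by
  subst hM
  have hAs : ∀ i j, ContDiff ℝ (⊤ : ℕ∞) (A i j) := fun i => (hA.1 i).1
  have hcx : cx f = fun y => (((⟨f, hf⟩ : smoothFun (Cn n)) : Cn n → ℝ) y : ℂ) +
      Complex.I * (((0 : smoothFun (Cn n)) : Cn n → ℝ) y : ℂ) := by
    funext y
    simp [cx]
  set T := {m : ℕ∞ | ∃ Ws : List (CVF n), (Ws.length : ℕ∞) = m ∧ (∀ W ∈ Ws, InM1B A W) ∧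
    (Ws.foldl (fun g W => W.act g) (cx f)) p ≠ 0}
  have hν : nuB A (cx f) p = sInf T := rfl
  rcases T.eq_empty_or_nonempty with h | h
  · right
    rw [hν, h, sInf_empty]
  obtain ⟨Ws, hlen, hWs, hne⟩ := csInf_mem h
  left
  rw [hν, ← hlen]
  rcases Nat.even_or_odd Ws.length with he | ho
  · obtain ⟨k, hk⟩ := he
    exact ⟨k, by rw [hk, two_mul]; push_cast; rfl⟩
  refine absurd ?_ hne
  rw [hcx]
  refine foldl_act_eq_zero_s7 hAs p Ws hWs _ _ fun w hw => ⟨?_, by simp⟩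
  refine apply_eq_zero_of_odd (S := {x | ρ x = 0}) hp (fun D hD => ?_) ⟨f, hf⟩ ?_ ho
    (fun k hk => apply_eq_zero_of_foldl_act p k ⟨f, hf⟩ fun Vs hVs hVA => ?_) w hw
  · obtain ⟨e, -, hX, rfl⟩ := hD
    exact exists_hasExpansion_expSeries hρ hX
      (fun x hx => fderiv_realField_eq_zero hρ hA.1 e hx) (hreg p hp)
  · exact eventually_nhdsWithin_iff.2 hpos
  · by_contra hV
    have h1 : sInf T ≤ (k : ℕ∞) := csInf_le (OrderBot.bddBelow _) ⟨Vs, by rw [hVs], hVA, hV⟩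
    rw [← hlen] at h1
    exact absurd (Nat.cast_le.1 h1) (not_le.2 hk)
end

section
/- Let M ⊂ ℂⁿ (n ≥ 2) be a smooth pseudoconvex real hypersurface with defining function ρ, let p ∈ M, let L be a smooth CR vector field along M that vanishes at no point, and let X, Y be smooth CR vector fields along M. Let 𝒟_L be the module of real vector fields on M generated over real smooth functions by Re L and Im L. If every iterated derivative of λ(X,X) along 𝒟_L of order ≤ 2j vanishes at p, and every iterated derivative of λ(Y,Y) along 𝒟_L of order ≤ 2k vanishes at p, then every iterated derivative of λ(X,Y) along 𝒟_L of order ≤ j+k+1 vanishes at p. -/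
open Topology

/-- Membership in the module `𝒟_L` of real vector fields generated over real smooth
functions by `Re L` and `Im L`; equivalently, fields of the form `c L + c̄ L̄` with `c`
smooth complex-valued. -/
def InDL {n : ℕ} (a : Fin n → Cn n → ℂ) (W : CVF n) : Prop :=
  ∃ c : Cn n → ℂ, ContDiff ℝ (⊤ : ℕ∞) c ∧
    (∀ j x, W.hol j x = c x * a j x) ∧
    (∀ j x, W.anti j x = starRingEnd ℂ (c x) * starRingEnd ℂ (a j x))

/-- The derivative of `g` along the vector field `V`. -/
noncomputable def dirDeriv {E F : Type*} [NormedAddCommGroup E] [NormedSpace ℝ E]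
    [NormedAddCommGroup F] [NormedSpace ℝ F] (V : E → E) (g : E → F) : E → F :=
  fun x => fderiv ℝ g x (V x)

section Flow

open Filter Asymptotics Finset

variable {E F : Type*} [NormedAddCommGroup E] [NormedSpace ℝ E]
  [NormedAddCommGroup F] [NormedSpace ℝ F]

theorem contDiff_dirDeriv {V : E → E} {g : E → F} (hV : ContDiff ℝ (⊤ : ℕ∞) V)
    (hg : ContDiff ℝ (⊤ : ℕ∞) g) : ContDiff ℝ (⊤ : ℕ∞) (dirDeriv V g) :=
  (hg.fderiv_right (m := (⊤ : ℕ∞)) (by norm_cast)).clm_apply hV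

theorem contDiff_iterate_dirDeriv {V : E → E} {g : E → F} (hV : ContDiff ℝ (⊤ : ℕ∞) V)
    (hg : ContDiff ℝ (⊤ : ℕ∞) g) (b : ℕ) : ContDiff ℝ (⊤ : ℕ∞) ((dirDeriv V)^[b] g) := by
  induction b with
  | zero => exact hg
  | succ b ih =>
    rw [Function.iterate_succ_apply']
    exact contDiff_dirDeriv hV ih

theorem dirDeriv_const_smul_left (t : ℝ) (V : E → E) (g : E → F) :
    dirDeriv (fun x => t • V x) g = t • dirDeriv V g := by
  ext x
  simp [dirDeriv]

theorem dirDeriv_const_smul_right {V : E → E} {g : E → F} (hg : ContDiff ℝ (⊤ : ℕ∞) g) (t : ℝ) :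
    dirDeriv V (t • g) = t • dirDeriv V g := by
  ext x
  have := hg.differentiable (by simp) x
  simp [dirDeriv, fderiv_const_smul this]

theorem iterate_dirDeriv_const_smul {V : E → E} {g : E → F} (hV : ContDiff ℝ (⊤ : ℕ∞) V)
    (hg : ContDiff ℝ (⊤ : ℕ∞) g) (t : ℝ) (b : ℕ) :
    (dirDeriv fun x => t • V x)^[b] g = t ^ b • (dirDeriv V)^[b] g := by
  induction b with
  | zero => simp
  | succ b ih =>
    rw [Function.iterate_succ_apply', Function.iterate_succ_apply', ih, dirDeriv_const_smul_left,
      dirDeriv_const_smul_right (contDiff_iterate_dirDeriv hV hg b), smul_smul, pow_succ']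

/-- Taylor expansion of `g` along an integral curve of `V` that stays in `K`. -/
theorem norm_sub_taylor_integralCurve_le {V : E → E} (hV : ContDiff ℝ (⊤ : ℕ∞) V) {K : Set E}
    {α : ℝ → E} {δ : ℝ} (hα : ∀ t, |t| < δ → HasDerivAt α (V (α t)) t)
    (hK : ∀ t, |t| < δ → α t ∈ K) {C : ℝ} (N : ℕ) :
    ∀ {g : E → F}, ContDiff ℝ (⊤ : ℕ∞) g → (∀ y ∈ K, ‖(dirDeriv V)^[N] g y‖ ≤ C) →
      ∀ t, |t| < δ → ‖g (α t) - ∑ b ∈ range N,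
        (t ^ b / (b.factorial : ℝ)) • (dirDeriv V)^[b] g (α 0)‖ ≤ C * |t| ^ N := by
  induction N with
  | zero =>
    intro g _ hC t ht
    simpa using hC _ (hK t ht)
  | succ N ih =>
    intro g hg hC t ht
    set R : ℝ → F := fun s => g (α s) - ∑ b ∈ range (N + 1),
        (s ^ b / (b.factorial : ℝ)) • (dirDeriv V)^[b] g (α 0) with hR
    set R' : ℝ → F := fun s => dirDeriv V g (α s) - ∑ b ∈ range N,
        (s ^ b / (b.factorial : ℝ)) • (dirDeriv V)^[b] (dirDeriv V g) (α 0) with hR'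
    have hderiv : ∀ s, |s| < δ → HasDerivAt R (R' s) s := by
      intro s hs
      refine HasDerivAt.sub ?_ ?_
      · exact ((hg.differentiable (by simp) (α s)).hasFDerivAt).comp_hasDerivAt s (hα s hs)
      · simp only [sum_range_succ']
        simp only [pow_zero]
        refine HasDerivAt.add_const _ (HasDerivAt.fun_sum fun b _ => ?_)
        rw [Function.iterate_succ_apply]
        refine HasDerivAt.smul_const ?_ _
        have h1 := (hasDerivAt_pow (b + 1) s).div_const ((b + 1).factorial : ℝ)
        convert h1 using 1
        have : (b.factorial : ℝ) ≠ 0 := by positivity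
        rw [Nat.factorial_succ]
        push_cast
        field_simp
    have hsub : ∀ s ∈ Set.Icc (-|t|) |t|, |s| ≤ |t| := fun s hs => abs_le.mpr hs
    have key := Convex.norm_image_sub_le_of_norm_hasDerivWithin_le (f := R) (f' := R')
      (s := Set.Icc (-|t|) |t|) (C := C * |t| ^ N) (x := 0) (y := t)
      (fun s hs => (hderiv s ((hsub s hs).trans_lt ht)).hasDerivWithinAt)
      (fun s hs => ?_) (convex_Icc _ _) (by simp) ⟨neg_abs_le t, le_abs_self t⟩
    · have h0 : R 0 = 0 := by
        simp [hR, sum_range_succ']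
      rw [h0, sub_zero, sub_zero, Real.norm_eq_abs] at key
      calc _ ≤ _ := key
        _ = _ := by ring
    · have h1 := ih (contDiff_dirDeriv hV hg) (by simpa [Function.iterate_succ_apply] using hC) s
        ((hsub s hs).trans_lt ht)
      have hC0 : 0 ≤ C := (norm_nonneg _).trans (hC _ (hK t ht))
      refine h1.trans ?_
      exact mul_le_mul_of_nonneg_left (pow_le_pow_left₀ (abs_nonneg _) (hsub s hs) _) hC0

/-- A local flow near `p`, continuous at `(p, 0)`. -/
theorem ContDiffAt.exists_localFlow [CompleteSpace E] {V : E → E} {p : E}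
    (hV : ContDiffAt ℝ 1 V p) :
    ∃ α : E × ℝ → E, ContinuousAt α (p, 0) ∧ α (p, 0) = p ∧
      ∀ᶠ δ in 𝓝[>] (0 : ℝ), ∀ x ∈ Metric.ball p δ, α (x, 0) = x ∧
        ∀ t, |t| < δ → HasDerivAt (fun s => α (x, s)) (V (α (x, t))) t := by
  obtain ⟨τ, hτ, a, r, L, K, hr, H⟩ := IsPicardLindelof.of_contDiffAt_one hV
  obtain ⟨α, hα, hc⟩ := (H 0).exists_forall_mem_closedBall_eq_hasDerivWithinAt_continuousOn
  have hr' : (0 : ℝ) < r := hr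
  refine ⟨α, hc.continuousAt ?_, (hα p (Metric.mem_closedBall_self hr'.le)).1, ?_⟩
  · exact prod_mem_nhds (Metric.closedBall_mem_nhds p hr')
      (Icc_mem_nhds (by linarith) (by linarith))
  · filter_upwards [Ioo_mem_nhdsGT (lt_min hr' hτ)] with δ hδ x hx
    have hδ2 := lt_min_iff.mp hδ.2
    have hx' : x ∈ Metric.closedBall p r := by
      rw [Metric.mem_ball] at hx
      exact Metric.mem_closedBall.mpr (by linarith)
    refine ⟨(hα x hx').1, fun t ht => ?_⟩
    have ht' := abs_lt.mp ht
    exact ((hα x hx').2 t ⟨by linarith, by linarith⟩).hasDerivAt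
      (Icc_mem_nhds (by linarith) (by linarith))

/-- `x'` is obtained from the moving point `x` by following `V` for time `ε`, to all orders. -/
def FlowsTo (V : E → E) (x x' : ℝ → E) : Prop :=
  ∀ g : E → ℂ, ContDiff ℝ (⊤ : ℕ∞) g → ∀ N : ℕ,
    (fun ε : ℝ => g (x' ε) - ∑ b ∈ range N,
      (ε ^ b / (b.factorial : ℝ)) • (dirDeriv V)^[b] g (x ε)) =O[𝓝[≠] 0] fun ε => ε ^ N

/-- A vector field tangent to a regular level set can be followed inside the level set. -/
theorem exists_flowsTo_of_tangent [ProperSpace E] {ρ : E → ℝ} (hρ : ContDiff ℝ (⊤ : ℕ∞) ρ)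
    {p : E} (hreg : fderiv ℝ ρ p ≠ 0) {V : E → E} (hV : ContDiff ℝ (⊤ : ℕ∞) V)
    (htan : ∀ x, ρ x = 0 → fderiv ℝ ρ x (V x) = 0) {x : ℝ → E}
    (hx : Tendsto x (𝓝[≠] 0) (𝓝 p)) (hxM : ∀ᶠ ε in 𝓝[≠] 0, ρ (x ε) = 0) :
    ∃ x' : ℝ → E, Tendsto x' (𝓝[≠] 0) (𝓝 p) ∧ (∀ᶠ ε in 𝓝[≠] 0, ρ (x' ε) = 0) ∧
      FlowsTo V x x' := by
  have : CompleteSpace E := inferInstance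
  obtain ⟨v, hv⟩ : ∃ v, fderiv ℝ ρ p v ≠ 0 := by
    by_contra! h
    exact hreg (ContinuousLinearMap.ext h)
  have hdv : ContDiff ℝ (⊤ : ℕ∞) (fun y => fderiv ℝ ρ y v) :=
    (hρ.fderiv_right (m := (⊤ : ℕ∞)) (by norm_cast)).clm_apply contDiff_const
  have hdV : ContDiff ℝ (⊤ : ℕ∞) (fun y => fderiv ℝ ρ y (V y)) :=
    (hρ.fderiv_right (m := (⊤ : ℕ∞)) (by norm_cast)).clm_apply hV
  -- The corrected field `V'` annihilates `ρ` near `p` and agrees with `V` on the level set.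
  set V' : E → E := fun y => V y - (fderiv ℝ ρ y (V y) / fderiv ℝ ρ y v) • v with hV'
  have hV'p : ContDiffAt ℝ 1 V' p := by
    refine ContDiffAt.sub (hV.contDiffAt.of_le (by norm_cast))
      (ContDiffAt.smul ?_ contDiffAt_const)
    exact (hdV.contDiffAt.of_le (by norm_cast)).div
      (hdv.contDiffAt.of_le (by norm_cast)) hv
  obtain ⟨α, hαc, hαp, hα⟩ := hV'p.exists_localFlow
  have hnear : ∀ᶠ y in 𝓝 p, fderiv ℝ ρ y v ≠ 0 ∧ y ∈ Metric.closedBall p 1 :=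
    (hdv.continuous.continuousAt.eventually_ne hv).and (Metric.closedBall_mem_nhds p one_pos)
  have hαt : Tendsto α (𝓝 (p, 0)) (𝓝 p) := by simpa [ContinuousAt, hαp] using hαc
  obtain ⟨δ₁, hδ₁, hball⟩ := Metric.eventually_nhds_iff.mp (hαt.eventually hnear)
  obtain ⟨δ, hδ, hδ0, hδlt⟩ := (hα.and (Ioo_mem_nhdsGT hδ₁)).exists
  have hU : ∀ y ∈ Metric.ball p δ, ∀ t, |t| < δ →
      fderiv ℝ ρ (α (y, t)) v ≠ 0 ∧ α (y, t) ∈ Metric.closedBall p 1 := by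
    intro y hy t ht
    apply hball
    rw [Prod.dist_eq, max_lt_iff]
    exact ⟨(Metric.mem_ball.mp hy).trans hδlt, by simpa using ht.trans hδlt⟩
  have hinv : ∀ y ∈ Metric.ball p δ, ρ y = 0 → ∀ t, |t| < δ → ρ (α (y, t)) = 0 := by
    intro y hy hy0 t ht
    have hd : ∀ s, |s| < δ → HasDerivAt (fun s => ρ (α (y, s))) 0 s := by
      intro s hs
      have h1 := ((hρ.differentiable (by simp) (α (y, s))).hasFDerivAt).comp_hasDerivAt s
        ((hδ y hy).2 s hs)
      have h2 : fderiv ℝ ρ (α (y, s)) (V' (α (y, s))) = 0 := by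
        have := (hU y hy s hs).1
        simp [hV', this]
      rw [h2] at h1
      exact h1
    have := Convex.norm_image_sub_le_of_norm_hasDerivWithin_le
      (f := fun s => ρ (α (y, s))) (f' := fun _ => 0)
      (s := Set.Icc (-|t|) |t|) (C := 0) (x := 0) (y := t)
      (fun s hs => (hd s ((abs_le.mpr hs).trans_lt ht)).hasDerivWithinAt)
      (fun s _ => by simp) (convex_Icc _ _) (by simp) ⟨neg_abs_le t, le_abs_self t⟩
    have h0 : ρ (α (y, 0)) = 0 := by rw [(hδ y hy).1, hy0]
    simpa [h0] using this
  have hid : Tendsto (fun ε : ℝ => ε) (𝓝[≠] 0) (𝓝 0) := nhdsWithin_le_nhds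
  have hxball : ∀ᶠ ε in 𝓝[≠] (0 : ℝ), x ε ∈ Metric.ball p δ :=
    hx.eventually (Metric.ball_mem_nhds p hδ0)
  have hεsmall : ∀ᶠ ε in 𝓝[≠] (0 : ℝ), |ε| < δ := by
    have := hid.eventually (Metric.ball_mem_nhds (0 : ℝ) hδ0)
    simpa using this
  refine ⟨fun ε => α (x ε, ε), hαt.comp (by simpa [nhds_prod_eq] using hx.prodMk hid), ?_, ?_⟩
  · filter_upwards [hxball, hεsmall, hxM] with ε h1 h2 h3 using hinv _ h1 h3 _ h2
  · intro g hg N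
    obtain ⟨C, hC⟩ := (isCompact_closedBall p 1).exists_bound_of_continuousOn
      (contDiff_iterate_dirDeriv hV hg N).continuous.continuousOn
    refine IsBigO.of_bound C ?_
    filter_upwards [hxball, hεsmall, hxM] with ε h1 h2 h3
    have hcurve : ∀ t, |t| < δ →
        HasDerivAt (fun s => α (x ε, s)) (V (α (x ε, t))) t := by
      intro t ht
      have h4 := (hδ _ h1).2 t ht
      have h5 := htan _ (hinv _ h1 h3 t ht)
      simpa [hV', h5] using h4
    have h6 := norm_sub_taylor_integralCurve_le hV hcurve
      (fun t ht => (hU _ h1 t ht).2) N hg hC ε h2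
    simpa [(hδ _ h1).1] using h6

end Flow

section Reach

open Filter Asymptotics Finset

variable {E : Type*} [NormedAddCommGroup E] [NormedSpace ℝ E]

/-- Moving points obtained from `p` by successively following fields of `S` inside `M`. -/
inductive Reach (S : Set (E → E)) (M : Set E) (p : E) : (ℝ → E) → Prop
  | const : Reach S M p fun _ => p
  | step {x x' : ℝ → E} {V : E → E} : Reach S M p x → V ∈ S →
      Tendsto x' (𝓝[≠] 0) (𝓝 p) → (∀ᶠ ε in 𝓝[≠] 0, x' ε ∈ M) → FlowsTo V x x' → Reach S M p x'

/-- The iterated derivative of `g` along a list of vector fields, the head acting first. -/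
noncomputable def listDeriv (Vs : List (E → E)) (g : E → ℂ) : E → ℂ :=
  Vs.foldl (fun g V => dirDeriv V g) g

variable {S : Set (E → E)} {M : Set E} {p : E}

theorem Reach.tendsto {x : ℝ → E} (hx : Reach S M p x) : Tendsto x (𝓝[≠] 0) (𝓝 p) := by
  cases hx with
  | const => exact tendsto_const_nhds
  | step _ _ h _ _ => exact h

theorem Reach.eventually_mem (hp : p ∈ M) {x : ℝ → E} (hx : Reach S M p x) :
    ∀ᶠ ε in 𝓝[≠] 0, x ε ∈ M := by
  cases hx with
  | const => exact Eventually.of_forall fun _ => hp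
  | step _ _ _ h _ => exact h

theorem isBigO_pow_of_le {m n : ℕ} (h : m ≤ n) :
    (fun ε : ℝ => ε ^ n) =O[𝓝[≠] 0] fun ε => ε ^ m := by
  refine IsBigO.of_bound 1 ?_
  filter_upwards [nhdsWithin_le_nhds (Metric.closedBall_mem_nhds (0 : ℝ) one_pos)] with ε hε
  rw [norm_pow, norm_pow, one_mul]
  exact pow_le_pow_of_le_one (norm_nonneg _) (by simpa using hε) h

theorem iterate_dirDeriv_eq_listDeriv (V : E → E) (b : ℕ) :
    ∀ g : E → ℂ, (dirDeriv V)^[b] g = listDeriv (List.replicate b V) g := by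
  induction b with
  | zero => intro g; rfl
  | succ b ih =>
    intro g
    rw [Function.iterate_succ_apply, ih]
    rfl

/-- Leading asymptotics of `g` along a reachable moving point. -/
theorem Reach.exists_leading (hS : ∀ V ∈ S, ContDiff ℝ (⊤ : ℕ∞) V) {x : ℝ → E}
    (hx : Reach S M p x) : ∀ (N : ℕ) (g : E → ℂ), ContDiff ℝ (⊤ : ℕ∞) g →
      (∀ Vs : List (E → E), Vs.length < N → (∀ V ∈ Vs, V ∈ S) → listDeriv Vs g p = 0) →
      ∃ d : ℂ, (fun ε : ℝ => g (x ε) - ε ^ N • d) =O[𝓝[≠] 0] fun ε => ε ^ (N + 1) := by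
  induction hx with
  | const =>
    intro N g _ hg
    rcases Nat.eq_zero_or_pos N with rfl | hN
    · exact ⟨g p, by simpa using isBigO_zero _ _⟩
    · have : g p = 0 := hg [] (by simpa using hN) (by simp)
      exact ⟨0, by simpa [this] using isBigO_zero _ _⟩
  | @step x x' V _ hV _ _ hflow ih =>
    intro N g hgs hg
    have hb : ∀ b ∈ range (N + 1), ∃ d : ℂ, (fun ε : ℝ => (dirDeriv V)^[b] g (x ε)
        - ε ^ (N - b) • d) =O[𝓝[≠] 0] fun ε => ε ^ (N - b + 1) := by
      intro b hb
      refine ih (N - b) _ (contDiff_iterate_dirDeriv (hS V hV) hgs b) fun Vs hl hVs => ?_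
      have := hg (List.replicate b V ++ Vs) (by simp at hb ⊢; omega) ?_
      · rw [iterate_dirDeriv_eq_listDeriv]
        simpa [listDeriv] using this
      · intro W hW
        rcases List.mem_append.mp hW with h | h
        · rw [List.eq_of_mem_replicate h]; exact hV
        · exact hVs W h
    choose! d hd using hb
    refine ⟨∑ b ∈ range (N + 1), (1 / (b.factorial : ℝ)) • d b, ?_⟩
    have h2 : (fun ε : ℝ => ∑ b ∈ range (N + 1), (ε ^ b / (b.factorial : ℝ)) •
        ((dirDeriv V)^[b] g (x ε) - ε ^ (N - b) • d b)) =O[𝓝[≠] 0] fun ε => ε ^ (N + 1) := by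
      refine IsBigO.fun_sum fun b hb => ?_
      have hbN : b ≤ N := by simpa [Nat.lt_succ_iff] using hb
      have h3 : (fun ε : ℝ => ε ^ b / (b.factorial : ℝ)) =O[𝓝[≠] 0] fun ε : ℝ => ε ^ b := by
        simp_rw [div_eq_inv_mul]
        exact (isBigO_refl _ _).const_mul_left _
      refine (h3.smul (hd b hb)).congr_right fun ε => ?_
      rw [smul_eq_mul, ← pow_add]
      congr 1
      omega
    refine ((hflow g hgs (N + 1)).add h2).congr_left fun ε => ?_
    simp only [smul_sub, sum_sub_distrib, smul_sum, smul_smul]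
    have h4 : ∀ b ∈ range (N + 1), (ε ^ b / (b.factorial : ℝ) * ε ^ (N - b)) • d b
        = (ε ^ N * (1 / (b.factorial : ℝ))) • d b := by
      intro b hb
      have hbN : b ≤ N := by simpa [Nat.lt_succ_iff] using hb
      rw [← Nat.add_sub_cancel' hbN, pow_add, Nat.add_sub_cancel' hbN]
      congr 1
      ring
    rw [sum_congr rfl h4]
    abel

/-- If `∑ b, i ^ b • u b` is small for `i = 0, …, m - 1`, then so is each `u b`. -/
theorem isBigO_of_sum_pow_smul {m : ℕ} {l : Filter ℝ} {u : Fin m → ℝ → ℂ} {w : ℝ → ℝ}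
    (h : ∀ i : Fin m, (fun ε => ∑ b : Fin m, ((i : ℕ) : ℝ) ^ (b : ℕ) • u b ε) =O[l] w)
    (b : Fin m) : u b =O[l] w := by
  set A : Matrix (Fin m) (Fin m) ℝ := Matrix.vandermonde fun i => ((i : ℕ) : ℝ) with hA
  have hdet : IsUnit A.det := by
    rw [isUnit_iff_ne_zero, hA, Matrix.det_vandermonde_ne_zero_iff]
    intro i j hij
    exact Fin.ext (by simpa using hij)
  have h2 : (fun ε => ∑ i : Fin m, A⁻¹ b i • ∑ c : Fin m, ((i : ℕ) : ℝ) ^ (c : ℕ) • u c ε)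
      =O[l] w := IsBigO.fun_sum fun i _ => (h i).const_smul_left (A⁻¹ b i)
  refine h2.congr_left fun ε => ?_
  simp only [smul_sum, smul_smul]
  rw [sum_comm]
  have h3 : ∀ c : Fin m, ∑ i : Fin m, (A⁻¹ b i * ((i : ℕ) : ℝ) ^ (c : ℕ)) • u c ε
      = (if b = c then (1 : ℝ) else 0) • u c ε := by
    intro c
    rw [← sum_smul]
    congr 1
    have := congrFun (congrFun (Matrix.nonsing_inv_mul A hdet) b) c
    rw [Matrix.mul_apply, Matrix.one_apply] at this
    rw [← this]
    rfl
  rw [sum_congr rfl fun c _ => h3 c]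
  simp

/-- Vanishing order along all reachable moving points drops by at most one under a derivative. -/
theorem isBigO_dirDeriv_of_reach (hS : ∀ V ∈ S, ContDiff ℝ (⊤ : ℕ∞) V)
    (hsmul : ∀ V ∈ S, ∀ t : ℝ, (fun x => t • V x) ∈ S)
    (hex : ∀ V ∈ S, ∀ x, Reach S M p x → ∃ x', Reach S M p x' ∧ FlowsTo V x x')
    {g : E → ℂ} (hg : ContDiff ℝ (⊤ : ℕ∞) g) {N : ℕ}
    (h : ∀ x, Reach S M p x → (fun ε : ℝ => g (x ε)) =O[𝓝[≠] 0] fun ε => ε ^ (N + 1))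
    {V : E → E} (hV : V ∈ S) {x : ℝ → E} (hx : Reach S M p x) :
    (fun ε : ℝ => dirDeriv V g (x ε)) =O[𝓝[≠] 0] fun ε => ε ^ N := by
  have key : ∀ i : Fin (N + 2), (fun ε : ℝ => ∑ b : Fin (N + 2), ((i : ℕ) : ℝ) ^ (b : ℕ) •
      ((ε ^ (b : ℕ) / ((b : ℕ).factorial : ℝ)) • (dirDeriv V)^[(b : ℕ)] g (x ε)))
      =O[𝓝[≠] 0] fun ε => ε ^ (N + 1) := by
    intro i
    obtain ⟨x', hx', hflow⟩ := hex _ (hsmul V hV ((i : ℕ) : ℝ)) x hx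
    have h1 := (h x' hx').sub ((hflow g hg (N + 2)).trans (isBigO_pow_of_le (Nat.le_succ _)))
    refine h1.congr_left fun ε => ?_
    rw [sub_sub_cancel, Finset.sum_range]
    refine sum_congr rfl fun b _ => ?_
    rw [iterate_dirDeriv_const_smul (hS V hV) hg, Pi.smul_apply, smul_comm]
  have h1 := isBigO_of_sum_pow_smul key ⟨1, by omega⟩
  simp only [pow_one, Nat.factorial_one, Nat.cast_one, div_one, Function.iterate_one] at h1
  have h2 : (fun ε : ℝ => ε⁻¹) =O[𝓝[≠] 0] fun ε : ℝ => ε⁻¹ := isBigO_refl _ _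
  refine (h2.smul h1).congr' ?_ ?_
  · filter_upwards [self_mem_nhdsWithin] with ε hε
    rw [smul_smul, inv_mul_cancel₀ hε, one_smul]
  · filter_upwards [self_mem_nhdsWithin] with ε hε
    have : ε ≠ 0 := hε
    rw [smul_eq_mul, pow_succ']
    field_simp

theorem listDeriv_eq_zero_of_reach (hS : ∀ V ∈ S, ContDiff ℝ (⊤ : ℕ∞) V)
    (hsmul : ∀ V ∈ S, ∀ t : ℝ, (fun x => t • V x) ∈ S)
    (hex : ∀ V ∈ S, ∀ x, Reach S M p x → ∃ x', Reach S M p x' ∧ FlowsTo V x x') :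
    ∀ (Vs : List (E → E)), (∀ V ∈ Vs, V ∈ S) → ∀ {g : E → ℂ}, ContDiff ℝ (⊤ : ℕ∞) g →
      (∀ x, Reach S M p x →
        (fun ε : ℝ => g (x ε)) =O[𝓝[≠] 0] fun ε => ε ^ (Vs.length + 1)) →
      listDeriv Vs g p = 0 := by
  intro Vs
  induction Vs with
  | nil =>
    intro _ g _ h
    have h1 := (h _ Reach.const).trans_tendsto (g'' := fun ε : ℝ => ε ^ 1) ?_
    · exact tendsto_nhds_unique tendsto_const_nhds h1
    · have : Tendsto (fun ε : ℝ => ε ^ 1) (𝓝 0) (𝓝 0) := by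
        simp only [pow_one]
        exact tendsto_id
      simpa using this.mono_left nhdsWithin_le_nhds
  | cons V Vs ih =>
    intro hVs g hg h
    have hV := hVs V (by simp)
    exact ih (fun W hW => hVs W (by simp [hW])) (contDiff_dirDeriv (hS V hV) hg)
      fun x hx => isBigO_dirDeriv_of_reach hS hsmul hex hg h hV hx

/-- A function with nonnegative real part on `M` vanishes to even order. -/
theorem isBigO_re_of_nonneg (hS : ∀ V ∈ S, ContDiff ℝ (⊤ : ℕ∞) V) (hp : p ∈ M) {f : E → ℂ}
    (hf : ContDiff ℝ (⊤ : ℕ∞) f) (hpos : ∀ y ∈ M, 0 ≤ (f y).re) {j : ℕ}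
    (hvan : ∀ Vs : List (E → E), Vs.length ≤ 2 * j → (∀ V ∈ Vs, V ∈ S) → listDeriv Vs f p = 0)
    {x : ℝ → E} (hx : Reach S M p x) :
    (fun ε : ℝ => (f (x ε)).re) =O[𝓝[≠] 0] fun ε => ε ^ (2 * j + 2) := by
  obtain ⟨d, hd⟩ := hx.exists_leading hS (2 * j + 1) f hf
    fun Vs hl hVs => hvan Vs (by omega) hVs
  have hre : (fun ε : ℝ => (f (x ε)).re - ε ^ (2 * j + 1) * d.re)
      =O[𝓝[≠] 0] fun ε : ℝ => ε ^ (2 * j + 2) := by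
    refine IsBigO.trans (IsBigO.of_bound 1 (Eventually.of_forall fun ε => ?_)) hd
    have := Complex.abs_re_le_norm (f (x ε) - ε ^ (2 * j + 1) • d)
    rw [Complex.sub_re, Complex.smul_re, smul_eq_mul] at this
    rwa [one_mul, Real.norm_eq_abs]
  suffices d.re = 0 by simpa [this] using hre
  obtain ⟨C, hC⟩ := hre.bound
  have hbound : ∀ᶠ ε in 𝓝[≠] (0 : ℝ), -(C * |ε| ^ (2 * j + 2)) ≤ ε ^ (2 * j + 1) * d.re := by
    filter_upwards [hC, hx.eventually_mem hp] with ε h1 h2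
    rw [Real.norm_eq_abs, norm_pow, Real.norm_eq_abs] at h1
    have := (abs_le.mp h1).2
    have := hpos _ h2
    linarith
  have hlim : Tendsto (fun ε : ℝ => C * |ε|) (𝓝 0) (𝓝 0) := by
    have : Continuous fun ε : ℝ => C * |ε| := by fun_prop
    simpa using this.tendsto 0
  refine le_antisymm ?_ ?_
  · refine ge_of_tendsto (hlim.mono_left (nhdsWithin_le_nhds (s := Set.Iio 0))) ?_
    filter_upwards [hbound.filter_mono (nhdsLT_le_nhdsNE 0), self_mem_nhdsWithin] with ε h1 h2
    have h2 : ε < 0 := h2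
    have h3 : 0 < |ε| ^ (2 * j + 1) := pow_pos (abs_pos.mpr h2.ne) _
    have h4 : ε ^ (2 * j + 1) = -|ε| ^ (2 * j + 1) := by
      rw [abs_of_neg h2, Odd.neg_pow (by simp)]
      ring
    rw [h4, pow_succ] at h1
    have h5 : |ε| ^ (2 * j + 1) * d.re ≤ |ε| ^ (2 * j + 1) * (C * |ε|) := by linarith
    exact le_of_mul_le_mul_left h5 h3
  · have hlim' := hlim.neg
    rw [neg_zero] at hlim'
    refine le_of_tendsto (hlim'.mono_left (nhdsWithin_le_nhds (s := Set.Ioi 0))) ?_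
    filter_upwards [hbound.filter_mono (nhdsGT_le_nhdsNE 0), self_mem_nhdsWithin] with ε h1 h2
    have h2 : 0 < ε := h2
    have h3 : 0 < ε ^ (2 * j + 1) := by positivity
    rw [abs_of_pos h2, pow_succ] at h1
    rw [abs_of_pos h2]
    have h5 : ε ^ (2 * j + 1) * (-(C * ε)) ≤ ε ^ (2 * j + 1) * d.re := by linarith
    exact le_of_mul_le_mul_left h5 h3

/-- Mixed vanishing for smooth functions with `|h|² ≤ f g` on a regular level set. -/
theorem listDeriv_eq_zero_of_norm_sq_le [ProperSpace E] {ρ : E → ℝ}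
    (hρ : ContDiff ℝ (⊤ : ℕ∞) ρ) (hp : ρ p = 0) (hreg : fderiv ℝ ρ p ≠ 0)
    (hS : ∀ V ∈ S, ContDiff ℝ (⊤ : ℕ∞) V)
    (hsmul : ∀ V ∈ S, ∀ t : ℝ, (fun x => t • V x) ∈ S)
    (htan : ∀ V ∈ S, ∀ x, ρ x = 0 → fderiv ℝ ρ x (V x) = 0)
    {f g h : E → ℂ} (hf : ContDiff ℝ (⊤ : ℕ∞) f) (hg : ContDiff ℝ (⊤ : ℕ∞) g)
    (hh : ContDiff ℝ (⊤ : ℕ∞) h) (hf0 : ∀ y, ρ y = 0 → 0 ≤ (f y).re)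
    (hg0 : ∀ y, ρ y = 0 → 0 ≤ (g y).re)
    (hle : ∀ y, ρ y = 0 → ‖h y‖ ^ 2 ≤ (f y).re * (g y).re) {j k : ℕ}
    (hfv : ∀ Vs : List (E → E), Vs.length ≤ 2 * j → (∀ V ∈ Vs, V ∈ S) → listDeriv Vs f p = 0)
    (hgv : ∀ Vs : List (E → E), Vs.length ≤ 2 * k → (∀ V ∈ Vs, V ∈ S) → listDeriv Vs g p = 0)
    (Vs : List (E → E)) (hlen : Vs.length ≤ j + k + 1) (hVs : ∀ V ∈ Vs, V ∈ S) :
    listDeriv Vs h p = 0 := by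
  set M : Set E := {y | ρ y = 0} with hM
  have hpM : p ∈ M := hp
  refine listDeriv_eq_zero_of_reach (M := M) hS hsmul ?_ Vs hVs hh ?_
  · intro V hV x hx
    obtain ⟨x', h1, h2, h3⟩ := exists_flowsTo_of_tangent hρ hreg (hS V hV) (htan V hV)
      hx.tendsto (hx.eventually_mem hpM)
    exact ⟨x', hx.step hV h1 h2 h3, h3⟩
  · intro x hx
    refine IsBigO.trans ?_ (isBigO_pow_of_le (n := j + k + 2) (by omega))
    refine IsBigO.of_pow two_ne_zero ?_
    have h1 := (isBigO_re_of_nonneg hS hpM hf hf0 hfv hx).mul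
      (isBigO_re_of_nonneg hS hpM hg hg0 hgv hx)
    refine (IsBigO.of_bound 1 ?_).trans (h1.congr_right fun ε => ?_)
    · filter_upwards [hx.eventually_mem hpM] with ε hε
      have := hle _ hε
      simpa using this.trans (le_abs_self _)
    · simp only [Pi.pow_apply]
      ring

end Reach

section Levi

open Finset

variable {n : ℕ}

theorem clm_apply_eq_sum_wirtinger (T : Cn n →L[ℝ] ℂ) (v : Cn n) :
    T v = (∑ j, v j * ((T (Pi.single j 1) - Complex.I * T (Pi.single j Complex.I)) / 2)) +
      ∑ j, starRingEnd ℂ (v j) *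
        ((T (Pi.single j 1) + Complex.I * T (Pi.single j Complex.I)) / 2) := by
  have hv : v = ∑ j, ((v j).re • (Pi.single j 1 : Cn n) +
      (v j).im • (Pi.single j Complex.I : Cn n)) := by
    conv_lhs => rw [← Finset.univ_sum_single v]
    refine sum_congr rfl fun j _ => ?_
    rw [← Pi.single_smul, ← Pi.single_smul, ← Pi.single_add]
    congr 1
    simp [Complex.re_add_im]
  conv_lhs => rw [hv]
  rw [map_sum, ← sum_add_distrib]
  refine sum_congr rfl fun j _ => ?_
  rw [map_add, map_smul, map_smul]
  set a := T (Pi.single j 1)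
  set b := T (Pi.single j Complex.I)
  have h1 : v j = (v j).re + (v j).im * Complex.I := (Complex.re_add_im _).symm
  have h2 : starRingEnd ℂ (v j) = (v j).re - (v j).im * Complex.I := by
    apply Complex.ext <;> simp
  rw [Complex.real_smul, Complex.real_smul]
  linear_combination -h1 * (a - Complex.I * b) / 2 - h2 * (a + Complex.I * b) / 2
    + (v j).im * b * Complex.I_sq

theorem CVF.act_eq_dirDeriv {a : Fin n → Cn n → ℂ} {W : CVF n} (hW : InDL a W) (g : Cn n → ℂ) :
    W.act g = dirDeriv (fun x j => W.hol j x) g := by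
  obtain ⟨c, -, h1, h2⟩ := hW
  ext x
  rw [dirDeriv, clm_apply_eq_sum_wirtinger]
  simp only [CVF.act, wz, wzb]
  congr 1
  refine sum_congr rfl fun j _ => ?_
  rw [h1, h2, map_mul]

/-- The real vector fields underlying `𝒟_L`, viewed as maps `ℂⁿ → ℂⁿ`. -/
def dlFields (a : Fin n → Cn n → ℂ) : Set (Cn n → Cn n) :=
  {V | ∃ c : Cn n → ℂ, ContDiff ℝ (⊤ : ℕ∞) c ∧ V = fun x j => c x * a j x}

theorem foldl_act_eq_listDeriv {a : Fin n → Cn n → ℂ} :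
    ∀ (Ws : List (CVF n)), (∀ W ∈ Ws, InDL a W) → ∀ g : Cn n → ℂ,
      Ws.foldl (fun g W => W.act g) g = listDeriv (Ws.map fun W x j => W.hol j x) g := by
  intro Ws
  induction Ws with
  | nil => intro _ g; rfl
  | cons W Ws ih =>
    intro h g
    rw [List.foldl_cons, ih (fun V hV => h V (by simp [hV])),
      CVF.act_eq_dirDeriv (h W (by simp))]
    rfl

theorem InDL.mem_dlFields {a : Fin n → Cn n → ℂ} {W : CVF n} (hW : InDL a W) :
    (fun x j => W.hol j x) ∈ dlFields a := by
  obtain ⟨c, hc, h1, -⟩ := hW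
  exact ⟨c, hc, by ext x j; exact h1 j x⟩

theorem listDeriv_eq_zero_of_foldl_act {a : Fin n → Cn n → ℂ} {g : Cn n → ℂ} {p : Cn n} {N : ℕ}
    (h : ∀ Ws : List (CVF n), Ws.length ≤ N → (∀ W ∈ Ws, InDL a W) →
      (Ws.foldl (fun g W => W.act g) g) p = 0)
    (Vs : List (Cn n → Cn n)) (hlen : Vs.length ≤ N) (hVs : ∀ V ∈ Vs, V ∈ dlFields a) :
    listDeriv Vs g p = 0 := by
  set lift : (Cn n → Cn n) → CVF n :=
    fun V => ⟨fun j x => V x j, fun j x => starRingEnd ℂ (V x j)⟩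
  have hlift : ∀ W ∈ Vs.map lift, InDL a W := by
    intro W hW
    obtain ⟨V, hV, rfl⟩ := List.mem_map.mp hW
    obtain ⟨c, hc, rfl⟩ := hVs V hV
    exact ⟨c, hc, fun _ _ => rfl, fun _ _ => map_mul _ _ _⟩
  have h1 := h (Vs.map lift) (by simpa using hlen) hlift
  rw [foldl_act_eq_listDeriv _ hlift, List.map_map] at h1
  have h2 : ((fun (W : CVF n) x j => W.hol j x) ∘ lift) = id := rfl
  rwa [h2, List.map_id] at h1

theorem fderiv_cx {ρ : Cn n → ℝ} (hρ : ContDiff ℝ (⊤ : ℕ∞) ρ) (x v : Cn n) :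
    fderiv ℝ (cx ρ) x v = (fderiv ℝ ρ x v : ℂ) := by
  have h := Complex.ofRealCLM.hasFDerivAt.comp x
    (hρ.differentiable (by simp) x).hasFDerivAt
  have h2 : HasFDerivAt (cx ρ) (Complex.ofRealCLM.comp (fderiv ℝ ρ x)) x := h
  rw [h2.fderiv]
  rfl

theorem wzb_cx {ρ : Cn n → ℝ} (hρ : ContDiff ℝ (⊤ : ℕ∞) ρ) (j : Fin n) (x : Cn n) :
    wzb j (cx ρ) x = starRingEnd ℂ (wz j (cx ρ) x) := by
  simp [wz, wzb, fderiv_cx hρ, map_ofNat]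

theorem fderiv_eq_zero_of_cr {ρ : Cn n → ℝ} (hρ : ContDiff ℝ (⊤ : ℕ∞) ρ) {x v : Cn n}
    (h : ∑ j, v j * wz j (cx ρ) x = 0) : fderiv ℝ ρ x v = 0 := by
  have h1 := clm_apply_eq_sum_wirtinger (fderiv ℝ (cx ρ) x) v
  have h2 : ∑ j, starRingEnd ℂ (v j) * wzb j (cx ρ) x = 0 := by
    have := congrArg (starRingEnd ℂ) h
    simpa [wzb_cx hρ] using this
  rw [fderiv_cx hρ] at h1
  change _ = (∑ j, v j * wz j (cx ρ) x) + ∑ j, starRingEnd ℂ (v j) * wzb j (cx ρ) x at h1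
  rw [h, h2, add_zero] at h1
  exact_mod_cast h1

theorem contDiff_fderiv_const {F : Type*} [NormedAddCommGroup F] [NormedSpace ℝ F] {g : Cn n → F}
    (hg : ContDiff ℝ (⊤ : ℕ∞) g) (v : Cn n) :
    ContDiff ℝ (⊤ : ℕ∞) fun x => fderiv ℝ g x v :=
  (hg.fderiv_right (m := (⊤ : ℕ∞)) (by norm_cast)).clm_apply contDiff_const

theorem contDiff_wz {g : Cn n → ℂ} (hg : ContDiff ℝ (⊤ : ℕ∞) g) (j : Fin n) :
    ContDiff ℝ (⊤ : ℕ∞) (wz j g) :=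
  ((contDiff_fderiv_const hg _).sub (contDiff_const.mul (contDiff_fderiv_const hg _))).div_const 2

theorem contDiff_wzb {g : Cn n → ℂ} (hg : ContDiff ℝ (⊤ : ℕ∞) g) (j : Fin n) :
    ContDiff ℝ (⊤ : ℕ∞) (wzb j g) :=
  ((contDiff_fderiv_const hg _).add (contDiff_const.mul (contDiff_fderiv_const hg _))).div_const 2

theorem contDiff_cx {ρ : Cn n → ℝ} (hρ : ContDiff ℝ (⊤ : ℕ∞) ρ) : ContDiff ℝ (⊤ : ℕ∞) (cx ρ) :=
  Complex.ofRealCLM.contDiff.comp hρ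

theorem contDiff_levi {ρ : Cn n → ℝ} (hρ : ContDiff ℝ (⊤ : ℕ∞) ρ) {ξ η : Fin n → Cn n → ℂ}
    (hξ : ∀ j, ContDiff ℝ (⊤ : ℕ∞) (ξ j)) (hη : ∀ j, ContDiff ℝ (⊤ : ℕ∞) (η j)) :
    ContDiff ℝ (⊤ : ℕ∞) (levi ρ ξ η) := by
  refine ContDiff.sum fun j _ => ContDiff.sum fun l _ => ?_
  exact ((contDiff_wz (contDiff_wzb (contDiff_cx hρ) l) j).mul (hξ j)).mul
    (Complex.conjCLE.contDiff.comp (hη l))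

theorem leviCoeff_conj {ρ : Cn n → ℝ} (hρ : ContDiff ℝ (⊤ : ℕ∞) ρ) (j l : Fin n) (x : Cn n) :
    starRingEnd ℂ (leviCoeff ρ j l x) = leviCoeff ρ l j x := by
  set D : Cn n → Cn n → ℝ := fun u v => fderiv ℝ (fderiv ℝ ρ) x u v with hD
  have hsymm : ∀ u v, D u v = D v u := fun u v =>
    (hρ.contDiffAt (x := x)).isSymmSndFDerivAt (by simp; norm_cast) u v
  have hfd : DifferentiableAt ℝ (fderiv ℝ ρ) x :=
    (hρ.fderiv_right (m := (⊤ : ℕ∞)) (by norm_cast)).differentiable (by simp) x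
  have hder : ∀ (l : Fin n) (u : Cn n), fderiv ℝ (wzb l (cx ρ)) x u
      = (D u (Pi.single l 1) + Complex.I * D u (Pi.single l Complex.I)) / 2 := by
    intro l u
    have h1 : ∀ v : Cn n, HasFDerivAt (fun y => ((fderiv ℝ ρ y v : ℝ) : ℂ))
        (Complex.ofRealCLM.comp ((fderiv ℝ (fderiv ℝ ρ) x).flip v)) x := fun v =>
      Complex.ofRealCLM.hasFDerivAt.comp x
        (by simpa using hfd.hasFDerivAt.clm_apply (hasFDerivAt_const v x))
    have h2 : wzb l (cx ρ) = fun y => ((fderiv ℝ ρ y (Pi.single l 1) : ℂ)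
        + Complex.I * (fderiv ℝ ρ y (Pi.single l Complex.I) : ℂ)) * (2 : ℂ)⁻¹ := by
      ext y
      simp [wzb, fderiv_cx hρ, div_eq_mul_inv]
    have h3 : HasFDerivAt (wzb l (cx ρ)) _ x :=
      h2 ▸ ((h1 (Pi.single l 1)).add ((h1 (Pi.single l Complex.I)).const_mul Complex.I)).mul_const
        (2 : ℂ)⁻¹
    rw [h3.fderiv]
    simp [hD]
    ring
  simp only [leviCoeff, wz, hder, map_div₀, map_sub, map_add, map_mul, Complex.conj_I,
    Complex.conj_ofReal, map_ofNat]
  rw [hsymm (Pi.single l 1) (Pi.single j 1), hsymm (Pi.single l 1) (Pi.single j Complex.I),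
    hsymm (Pi.single l Complex.I) (Pi.single j 1),
    hsymm (Pi.single l Complex.I) (Pi.single j Complex.I)]
  ring

/-- Cauchy–Schwarz for a Hermitian form that is nonnegative on the span of `u` and `v`. -/
theorem norm_sq_hermitian_le {H : Fin n → Fin n → ℂ}
    (hH : ∀ j l, starRingEnd ℂ (H j l) = H l j) {B : (Fin n → ℂ) → (Fin n → ℂ) → ℂ}
    (hB : ∀ u v, B u v = ∑ j, ∑ l, H j l * u j * starRingEnd ℂ (v l)) {u v : Fin n → ℂ}
    (hpos : ∀ s : ℂ, 0 ≤ (B (fun j => u j + s * v j) fun j => u j + s * v j).re) :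
    ‖B u v‖ ^ 2 ≤ (B u u).re * (B v v).re := by
  have hconj : B v u = starRingEnd ℂ (B u v) := by
    rw [hB, hB, map_sum, sum_comm]
    refine sum_congr rfl fun j _ => ?_
    rw [map_sum]
    refine sum_congr rfl fun l _ => ?_
    rw [map_mul, map_mul, hH, Complex.conj_conj]
    ring
  have hexp : ∀ s : ℂ, (B (fun j => u j + s * v j) fun j => u j + s * v j)
      = B u u + starRingEnd ℂ s * B u v + s * B v u + s * starRingEnd ℂ s * B v v := by
    intro s
    simp only [hB, mul_sum, ← sum_add_distrib]
    refine sum_congr rfl fun j _ => sum_congr rfl fun l _ => ?_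
    rw [map_add, map_mul]
    ring
  have hquad : ∀ r : ℝ, 0 ≤ (‖B u v‖ ^ 2 * (B v v).re) * (r * r) + (2 * ‖B u v‖ ^ 2) * r
      + (B u u).re := by
    intro r
    have h1 := hpos (r * B u v)
    rw [hexp, hconj, map_mul, Complex.conj_ofReal] at h1
    have h2 : starRingEnd ℂ (B u v) * B u v = ((‖B u v‖ ^ 2 : ℝ) : ℂ) := by
      rw [mul_comm, Complex.mul_conj, Complex.normSq_eq_norm_sq]
    have h3 : B u u + r * starRingEnd ℂ (B u v) * B u v + r * B u v * starRingEnd ℂ (B u v)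
        + r * B u v * (r * starRingEnd ℂ (B u v)) * B v v
        = B u u + ((2 * ‖B u v‖ ^ 2 * r : ℝ) : ℂ) + ((‖B u v‖ ^ 2 * (r * r) : ℝ) : ℂ) * B v v := by
      rw [show ((2 * ‖B u v‖ ^ 2 * r : ℝ) : ℂ) = 2 * ((‖B u v‖ ^ 2 : ℝ) : ℂ) * r by push_cast; ring,
        show ((‖B u v‖ ^ 2 * (r * r) : ℝ) : ℂ) = ((‖B u v‖ ^ 2 : ℝ) : ℂ) * (r * r) by
          push_cast; ring, ← h2]
      ring
    rw [h3, Complex.add_re, Complex.add_re, Complex.ofReal_re, Complex.re_ofReal_mul] at h1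
    linarith
  have hdisc := discrim_le_zero hquad
  rw [discrim] at hdisc
  rcases eq_or_ne (B u v) 0 with h0 | h0
  · have hu : 0 ≤ (B u u).re := by simpa using hpos 0
    have hv : 0 ≤ (B v v).re := by
      by_contra! hneg
      obtain ⟨r, hr⟩ := exists_nat_gt ((B u u).re / -(B v v).re)
      have h1 := hpos (r + 1 : ℝ)
      rw [hexp, hconj, h0, Complex.conj_ofReal, ← Complex.ofReal_mul] at h1
      simp only [map_zero, mul_zero, add_zero, Complex.add_re, Complex.re_ofReal_mul] at h1
      rw [div_lt_iff₀ (by linarith)] at hr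
      have : (0 : ℝ) ≤ r := by positivity
      nlinarith
    simpa [h0] using mul_nonneg hu hv
  · have hpos' : 0 < ‖B u v‖ ^ 2 := by positivity
    nlinarith

end Levi

/-- Let `M ⊂ ℂⁿ` (`n ≥ 2`) be a smooth pseudoconvex hypersurface, `L` a
nowhere-vanishing smooth CR vector field, `X, Y` smooth CR vector fields along `M`. If all
iterated `𝒟_L`-derivatives of `λ(X,X)` of order `≤ 2j` vanish at `p` and all iterated
`𝒟_L`-derivatives of `λ(Y,Y)` of order `≤ 2k` vanish at `p`, then all iterated
`𝒟_L`-derivatives of `λ(X,Y)` of order `≤ j+k+1` vanish at `p`. -/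
theorem levi_mixed_vanishing {n : ℕ} (hn : 2 ≤ n) (ρ : Cn n → ℝ)
    (hρ : ContDiff ℝ (⊤ : ℕ∞) ρ)
    (M : Set (Cn n)) (hM : M = {x | ρ x = 0}) (hreg : ∀ x ∈ M, fderiv ℝ ρ x ≠ 0)
    (hpsc : Pseudoconvex ρ M)
    (p : Cn n) (hp : p ∈ M)
    (a : Fin n → Cn n → ℂ) (ha : IsCRField ρ M a) (hnv : ∀ x ∈ M, (fun j => a j x) ≠ 0)
    (ξ η : Fin n → Cn n → ℂ) (hξ : IsCRField ρ M ξ) (hη : IsCRField ρ M η)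
    (j k : ℕ)
    (hXX : ∀ Ws : List (CVF n), Ws.length ≤ 2 * j → (∀ W ∈ Ws, InDL a W) →
      (Ws.foldl (fun g W => W.act g) (levi ρ ξ ξ)) p = 0)
    (hYY : ∀ Ws : List (CVF n), Ws.length ≤ 2 * k → (∀ W ∈ Ws, InDL a W) →
      (Ws.foldl (fun g W => W.act g) (levi ρ η η)) p = 0) :
    ∀ Ws : List (CVF n), Ws.length ≤ j + k + 1 → (∀ W ∈ Ws, InDL a W) →
      (Ws.foldl (fun g W => W.act g) (levi ρ ξ η)) p = 0 := by
  subst hM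
  have hlin : ∀ x, ρ x = 0 → ∀ ζ : Fin n → Cn n → ℂ, IsCRField ρ {x | ρ x = 0} ζ →
      0 ≤ (levi ρ ζ ζ x).re := fun x hx ζ hζ => hpsc x hx (fun i => ζ i x) (hζ.2 x hx)
  intro Ws hlen hWs
  rw [foldl_act_eq_listDeriv Ws hWs]
  refine listDeriv_eq_zero_of_norm_sq_le (S := dlFields a) hρ hp (hreg p hp) ?_ ?_ ?_
    (contDiff_levi hρ hξ.1 hξ.1) (contDiff_levi hρ hη.1 hη.1) (contDiff_levi hρ hξ.1 hη.1)
    (fun x hx => hlin x hx ξ hξ) (fun x hx => hlin x hx η hη) ?_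
    (listDeriv_eq_zero_of_foldl_act hXX) (listDeriv_eq_zero_of_foldl_act hYY) _
    (by simpa using hlen) ?_
  · rintro V ⟨c, hc, rfl⟩
    exact contDiff_pi.mpr fun i => hc.mul (ha.1 i)
  · rintro V ⟨c, hc, rfl⟩ t
    refine ⟨fun x => t • c x, hc.const_smul t, ?_⟩
    ext x i
    simp [mul_assoc]
  · rintro V ⟨c, hc, rfl⟩ x hx
    refine fderiv_eq_zero_of_cr hρ ?_
    simp only [mul_assoc, ← Finset.mul_sum]
    rw [ha.2 x hx, mul_zero]
  · intro x hx
    refine norm_sq_hermitian_le (H := fun i l => leviCoeff ρ i l x)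
      (fun i l => leviCoeff_conj hρ i l x)
      (B := fun u v => ∑ i, ∑ l, leviCoeff ρ i l x * u i * starRingEnd ℂ (v l))
      (fun _ _ => rfl) (u := fun i => ξ i x) (v := fun i => η i x) fun s => ?_
    refine hpsc x hx _ ?_
    simp only [add_mul, Finset.sum_add_distrib, mul_assoc, ← Finset.mul_sum]
    rw [hξ.2 x hx, hη.2 x hx, mul_zero, add_zero]
  · intro V hV
    obtain ⟨W, hW, rfl⟩ := List.mem_map.mp hV
    exact (hWs W hW).mem_dlFields
end
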